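/- Let R be a commutative noetherian ring satisfying condition (†), let P be a finitely generated abelian group, let L be a lattice, let σ ⊆ L_ℚ be a strongly convex rational polyhedral cone, and let ψ: L → P make A = R[σ∩L] a P-graded R-algebra. Assume that for every face τ ∈ Δ of σ, every finitely generated projective module over A_τ = R[τ∩L] and every finitely generated projective module over the degree-zero subring (A_τ)^G = (A_τ)_0 is extended from R. Then every finitely generated P-graded A-module that is projective as an A-module is trivial, i.e., isomorphic as a P-graded A-module to F ⊗_R A for some P-graded R-module F that is finitely generated projective over R. -/

import Mathlib

open scoped TensorProduct

universe u

/-! ### Properties of commutative (additive) monoids -/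

/-- `Q` is cancellative: `a + x = a + y → x = y`. -/
def IsCancellativeAddMonoid (Q : Type*) [AddCommMonoid Q] : Prop :=
  ∀ a x y : Q, a + x = a + y → x = y

/-- `Q` is torsion-free: `n • x = n • y` for some `n > 0` implies `x = y`. -/
def IsTorsionFreeAddMonoid (Q : Type*) [AddCommMonoid Q] : Prop :=
  ∀ n : ℕ, 0 < n → ∀ x y : Q, n • x = n • y → x = y

/-- `Q` is seminormal: an element `x = a - b` of the Grothendieck group with
`2x, 3x ∈ Q` lies in `Q` (stated elementwise via representatives). -/
def IsSeminormalAddMonoid (Q : Type*) [AddCommMonoid Q] : Prop :=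
  ∀ a b : Q, (∃ y : Q, a + a = b + b + y) → (∃ z : Q, a + a + a = b + b + b + z) →
    ∃ w : Q, a = b + w

/-- `Q` is normal: an element `x = a - b` of the Grothendieck group with
`n • x ∈ Q` for some `n > 0` lies in `Q` (stated elementwise via representatives). -/
def IsNormalAddMonoid (Q : Type*) [AddCommMonoid Q] : Prop :=
  ∀ a b : Q, (∃ n : ℕ, 0 < n ∧ ∃ y : Q, n • a = n • b + y) → ∃ w : Q, a = b + w

/-- `Q` has no nontrivial unit: `x + y = 0 → x = 0`. -/
def HasNoNontrivialAddUnits (Q : Type*) [AddCommMonoid Q] : Prop :=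
  ∀ x y : Q, x + y = 0 → x = 0

/-! ### Freeness/extension conditions on rings -/

/-- Every (not necessarily finitely generated) projective `R`-module is free. -/
def AllProjectiveFree (R : Type u) [CommRing R] : Prop :=
  ∀ (M : Type u) [AddCommGroup M] [Module R M], Module.Projective R M → Module.Free R M

/-- Every finitely generated projective `B`-module is free. -/
def AllFGProjectiveFree (B : Type u) [CommRing B] : Prop :=
  ∀ (M : Type u) [AddCommGroup M] [Module B M],
    Module.Finite B M → Module.Projective B M → Module.Free B M

/-- Every finitely generated projective `B`-module is extended from `R`, i.e. of the form
`B ⊗_R F` for a finitely generated projective `R`-module `F`. -/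
def AllFGProjectiveExtended (R B : Type u) [CommRing R] [CommRing B] [Algebra R B] : Prop :=
  ∀ (M : Type u) [AddCommGroup M] [Module B M],
    Module.Finite B M → Module.Projective B M →
    ∃ (F : Type u) (_ : AddCommGroup F) (_ : Module R F),
      Module.Finite R F ∧ Module.Projective R F ∧ Nonempty (M ≃ₗ[B] B ⊗[R] F)

/-- Condition (†): every projective `R`-module is free and every finitely generated
projective module over the group algebra `R[Q]` of a torsion-free abelian group `Q`
is extended from `R`. -/
def CondDagger (R : Type u) [CommRing R] : Prop :=
  AllProjectiveFree R ∧
  ∀ (Q : Type u) [AddCommGroup Q], IsTorsionFreeAddMonoid Q →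
    AllFGProjectiveExtended R (AddMonoidAlgebra R Q)

/-- Condition (††): every projective `R`-module is free and every finitely generated
projective module over `R[Q × ℤ^n]` is extended from `R`, whenever `Q` is torsion-free,
seminormal, cancellative and has no nontrivial unit. -/
def CondDaggerDagger (R : Type u) [CommRing R] : Prop :=
  AllProjectiveFree R ∧
  ∀ (n : ℕ) (Q : Type u) [AddCommMonoid Q],
    IsCancellativeAddMonoid Q → IsTorsionFreeAddMonoid Q → IsSeminormalAddMonoid Q →
    HasNoNontrivialAddUnits Q →
    AllFGProjectiveExtended R (AddMonoidAlgebra R (Q × (Fin n → ℤ)))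

/-! ### Gradings -/

/-- A map `f` is degree-preserving for the gradings `ℳ`, `𝒩`. -/
def MapsGraded {P M N : Type*} {R : Type*} [Semiring R] [AddCommMonoid M] [AddCommMonoid N]
    [Module R M] [Module R N] (f : M → N)
    (ℳ : P → Submodule R M) (𝒩 : P → Submodule R N) : Prop :=
  ∀ c : P, ∀ m ∈ ℳ c, f m ∈ 𝒩 c

/-- `𝒜` is a `P`-grading of the `R`-algebra `A`:
`A = ⊕_{a ∈ P} A_a`, `A_a · A_b ⊆ A_{a+b}`, `1 ∈ A_0`. -/
structure IsGradedRing {R A P : Type*} [CommRing R] [Ring A] [Algebra R A]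
    [AddCommGroup P] [DecidableEq P] (𝒜 : P → Submodule R A) : Prop where
  is_internal : DirectSum.IsInternal 𝒜
  one_mem : (1 : A) ∈ 𝒜 0
  mul_mem : ∀ {a b : P} {x y : A}, x ∈ 𝒜 a → y ∈ 𝒜 b → x * y ∈ 𝒜 (a + b)

/-- `ℳ` is a `P`-grading of the `A`-module `M`, compatible with the grading `𝒜` of `A`:
`M = ⊕_{a ∈ P} M_a` and `A_a • M_b ⊆ M_{a+b}`. -/
structure IsGradedModule {R A P M : Type*} [CommRing R] [Ring A] [Algebra R A]
    [AddCommGroup P] [DecidableEq P] [AddCommGroup M] [Module R M] [Module A M]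
    [IsScalarTower R A M] (𝒜 : P → Submodule R A) (ℳ : P → Submodule R M) : Prop where
  is_internal : DirectSum.IsInternal ℳ
  smul_mem : ∀ {a b : P} {x : A} {m : M}, x ∈ 𝒜 a → m ∈ ℳ b → x • m ∈ ℳ (a + b)

/-- The natural `P`-grading on `B ⊗[R] F`: `(B ⊗ F)_c = ⊕_{a+b=c} B_a ⊗ F_b`. -/
noncomputable def tensorGrading {R B F P : Type*} [CommRing R] [CommRing B] [Algebra R B]
    [AddCommGroup P] [AddCommGroup F] [Module R F]
    (ℬ : P → Submodule R B) (ℱ : P → Submodule R F) : P → Submodule R (B ⊗[R] F) :=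
  fun c => Submodule.span R
    {z | ∃ a b : P, a + b = c ∧ ∃ x ∈ ℬ a, ∃ f ∈ ℱ b, z = x ⊗ₜ[R] f}

/-- A `P`-graded `A`-module `(M, ℳ)` is (equivariantly) extended from `R`, i.e. trivial:
it is isomorphic, as a `P`-graded `A`-module, to `A ⊗_R F` for some `P`-graded `R`-module
`F` which is finitely generated and projective over `R`. -/
def IsGradedExtendedFrom (R : Type u) {A P : Type u} [CommRing R] [CommRing A]
    [Algebra R A] [AddCommGroup P] [DecidableEq P] (𝒜 : P → Submodule R A)
    (M : Type u) [AddCommGroup M] [Module R M] [Module A M] [IsScalarTower R A M]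
    (ℳ : P → Submodule R M) : Prop :=
  ∃ (F : Type u) (_ : AddCommGroup F) (_ : Module R F) (ℱ : P → Submodule R F),
    DirectSum.IsInternal ℱ ∧ Module.Finite R F ∧ Module.Projective R F ∧
    ∃ e : M ≃ₗ[A] A ⊗[R] F,
      MapsGraded (⇑e) ℳ (tensorGrading 𝒜 ℱ) ∧ MapsGraded (⇑e.symm) (tensorGrading 𝒜 ℱ) ℳ

/-! ### Monoid algebras, cones and faces -/

/-- The grading of a monoid algebra `R[Λ]` induced by a degree function `deg : Λ → P`:
the piece of degree `p` is spanned by the monomials `e_s` with `deg s = p`. -/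
noncomputable def monAlgGrading (R : Type*) [CommRing R] {Λ P : Type*} [AddCommMonoid Λ]
    (deg : Λ → P) : P → Submodule R (AddMonoidAlgebra R Λ) :=
  fun p => Submodule.span R {x | ∃ s : Λ, deg s = p ∧ x = AddMonoidAlgebra.single s 1}

/-- The lattice points `σ ∩ L` of the rational polyhedral cone
`σ = ⋂ᵢ (l i)⁻¹(ℚ≥0)` in `L ⊗ ℚ`. -/
def coneLatticePoints {L : Type*} [AddCommGroup L] {q : ℕ} (l : Fin q → L →+ ℚ) :
    AddSubmonoid L where
  carrier := {m | ∀ i, 0 ≤ l i m}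
  zero_mem' := fun i => by simp
  add_mem' := by
    intro a b ha hb i
    rw [map_add]
    exact add_nonneg (ha i) (hb i)

/-- The lattice points `τ ∩ L` of the face `τ = σ ∩ l'⁻¹(0)` of the cone `σ`. -/
def faceLatticePoints {L : Type*} [AddCommGroup L] {q : ℕ} (l : Fin q → L →+ ℚ)
    (l' : L →+ ℚ) : AddSubmonoid L where
  carrier := {m | (∀ i, 0 ≤ l i m) ∧ l' m = 0}
  zero_mem' := ⟨fun i => by simp, by simp⟩
  add_mem' := by
    intro a b ha hb
    refine ⟨fun i => ?_, ?_⟩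
    · rw [map_add]; exact add_nonneg (ha.1 i) (hb.1 i)
    · rw [map_add, ha.2, hb.2, add_zero]

/-- The submonoid of elements of a submonoid `S ⊆ L` killed by `ψ : L →+ P`
(the "invariant" part of `S`). -/
def kerSubmonoidIn {L P : Type*} [AddCommMonoid L] [AddCommMonoid P]
    (S : AddSubmonoid L) (ψ : L →+ P) : AddSubmonoid L where
  carrier := {m | m ∈ S ∧ ψ m = 0}
  zero_mem' := ⟨S.zero_mem, map_zero ψ⟩
  add_mem' := by
    intro a b ha hb
    exact ⟨S.add_mem ha.1 hb.1, by rw [map_add, ha.2, hb.2, add_zero]⟩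

/-- The kernel submonoid `{q ∈ Q | u q = 0}` of a monoid homomorphism `u : Q →+ P`. -/
def kerSubmonoid {Q P : Type*} [AddCommMonoid Q] [AddCommMonoid P] (u : Q →+ P) :
    AddSubmonoid Q where
  carrier := {q | u q = 0}
  zero_mem' := map_zero u
  add_mem' := by
    intro a b ha hb
    simp only [Set.mem_setOf_eq] at *
    rw [map_add, ha, hb, add_zero]

/-- `S` spans `L ⊗ ℚ`: a positive multiple of every lattice element is a difference of
elements of `S` (this expresses that the cone is "strongly convex", i.e. spans `L_ℚ`). -/
def SpansLattice {L : Type*} [AddCommGroup L] (S : AddSubmonoid L) : Prop :=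
  ∀ m : L, ∃ n : ℕ, 0 < n ∧ ∃ x ∈ S, ∃ y ∈ S, (n : ℤ) • m = x - y

section Supports

variable {R L : Type*} [CommRing R]

/-- The elements of `R[L]` whose support is contained in `X`. -/
def supportedOn (R : Type*) [CommRing R] {L : Type*} (X : Set L) :
    Submodule R (AddMonoidAlgebra R L) where
  carrier := {x | ∀ s, x.coeff s ≠ 0 → s ∈ X}
  zero_mem' := fun s hs => absurd rfl hs
  add_mem' := by
    intro x y hx hy s hs
    by_cases h : x.coeff s = 0
    · refine hy s fun h' => hs ?_
      simp [h, h']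
    · exact hx s h
  smul_mem' := by
    intro c x hx s hs
    refine hx s fun h => hs ?_
    simp [h]

lemma supportedOn_mono {X Y : Set L} {x : AddMonoidAlgebra R L} (hx : x ∈ supportedOn R X)
    (h : ∀ s ∈ X, s ∈ Y) : x ∈ supportedOn R Y :=
  fun s hs => h s (hx s hs)

lemma single_mem_supportedOn {X : Set L} {s : L} (hs : s ∈ X) (r : R) :
    AddMonoidAlgebra.single s r ∈ supportedOn R X := by
  intro t ht
  by_cases h : s = t
  · exact h ▸ hs
  · exact absurd (by simp [h]) ht

lemma mul_mem_supportedOn [AddCommMonoid L] {X Y Z : Set L} (h : ∀ a ∈ X, ∀ b ∈ Y, a + b ∈ Z)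
    {x y : AddMonoidAlgebra R L} (hx : x ∈ supportedOn R X) (hy : y ∈ supportedOn R Y) :
    x * y ∈ supportedOn R Z := by
  classical
  intro s hs
  have := AddMonoidAlgebra.support_coeff_mul_subset x y (Finsupp.mem_support_iff.2 hs)
  obtain ⟨a, ha, b, hb, rfl⟩ := Finset.mem_add.1 this
  exact h a (hx a (Finsupp.mem_support_iff.1 ha)) b (hy b (Finsupp.mem_support_iff.1 hb))

variable [AddCommGroup L]

open Classical in
/-- The `R`-linear endomorphism of `R[L]` that keeps the monomials on which `f` vanishes and kills
all others. -/
noncomputable def faceProj (R : Type*) [CommRing R] {L : Type*} [AddCommGroup L] (f : L →+ ℤ) :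
    AddMonoidAlgebra R L →ₗ[R] AddMonoidAlgebra R L where
  toFun x := .ofCoeff (x.coeff.filter fun s => f s = 0)
  map_add' x y := by ext s; simp [Finsupp.filter_apply]
  map_smul' c x := by ext s; simp [Finsupp.filter_apply]

open Classical in
lemma coeff_faceProj (f : L →+ ℤ) (x : AddMonoidAlgebra R L) (s : L) :
    (faceProj R f x).coeff s = if f s = 0 then x.coeff s else 0 := by
  simp [faceProj, Finsupp.filter_apply]

lemma faceProj_mem {X : Set L} (f : L →+ ℤ) {x : AddMonoidAlgebra R L}
    (hx : x ∈ supportedOn R X) : faceProj R f x ∈ supportedOn R (X ∩ {s | f s = 0}) := by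
  intro s hs
  rw [coeff_faceProj] at hs
  split_ifs at hs with h
  · exact ⟨hx s hs, h⟩
  · exact absurd rfl hs

lemma faceProj_comm (f g : L →+ ℤ) (x : AddMonoidAlgebra R L) :
    faceProj R f (faceProj R g x) = faceProj R g (faceProj R f x) := by
  ext s
  simp only [coeff_faceProj]
  split_ifs <;> rfl

lemma faceProj_eq_self {f : L →+ ℤ} {x : AddMonoidAlgebra R L}
    (hx : x ∈ supportedOn R {s | f s = 0}) : faceProj R f x = x := by
  ext s
  rw [coeff_faceProj]
  split_ifs with h
  · rfl
  · by_contra h'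
    exact h (hx s (Ne.symm h'))

lemma faceProj_eq_zero {f : L →+ ℤ} {x : AddMonoidAlgebra R L}
    (hx : x ∈ supportedOn R {s | f s ≠ 0}) : faceProj R f x = 0 := by
  ext s
  rw [coeff_faceProj]
  split_ifs with h
  · by_contra h'
    exact hx s h' h
  · rfl

lemma ne_zero_of_faceProj_eq_zero {f : L →+ ℤ} {x : AddMonoidAlgebra R L}
    (hx : faceProj R f x = 0) : x ∈ supportedOn R {s | f s ≠ 0} := by
  intro s hs h
  have := congrArg (fun y => AddMonoidAlgebra.coeff y s) hx
  simp only [coeff_faceProj, h, if_true] at this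
  exact hs (by simpa using this)

open Classical in
lemma faceProj_single (f : L →+ ℤ) (s : L) (r : R) :
    faceProj R f (.single s r) = if f s = 0 then .single s r else 0 := by
  ext t
  rw [coeff_faceProj]
  by_cases h : s = t
  · subst h; split_ifs <;> simp
  · split_ifs <;> simp [h]

lemma faceProj_one (f : L →+ ℤ) : faceProj R f 1 = 1 := by
  rw [AddMonoidAlgebra.one_def, faceProj_single, if_pos (map_zero f)]

lemma sum_single_coeff {R L : Type*} [CommRing R] (x : AddMonoidAlgebra R L) :
    x = ∑ s ∈ x.coeff.support, AddMonoidAlgebra.single s (x.coeff s) := by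
  apply AddMonoidAlgebra.coeff_injective
  rw [AddMonoidAlgebra.coeff_sum]
  exact (Finsupp.sum_single x.coeff).symm

lemma faceProj_mul {f : L →+ ℤ} {x y : AddMonoidAlgebra R L}
    (hx : x ∈ supportedOn R {s | 0 ≤ f s}) (hy : y ∈ supportedOn R {s | 0 ≤ f s}) :
    faceProj R f (x * y) = faceProj R f x * faceProj R f y := by
  rw [sum_single_coeff x, sum_single_coeff y, Finset.sum_mul_sum]
  simp only [map_sum, Finset.sum_mul_sum]
  refine Finset.sum_congr rfl fun s hs => Finset.sum_congr rfl fun t ht => ?_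
  have h1 : 0 ≤ f s := hx s (Finsupp.mem_support_iff.1 hs)
  have h2 : 0 ≤ f t := hy t (Finsupp.mem_support_iff.1 ht)
  rw [AddMonoidAlgebra.single_mul_single]
  simp only [faceProj_single, map_add]
  by_cases h3 : f s = 0
  · by_cases h4 : f t = 0
    · simp [h3, h4, AddMonoidAlgebra.single_mul_single]
    · simp [h3, h4]
  · have : f s + f t ≠ 0 := by lia
    simp [h3, this]

end Supports

section GradedMatrices

variable {R L P : Type*} [CommRing R] [AddCommGroup L] [AddCommGroup P] {q : ℕ}
  {l : Fin q → L →+ ℤ} {ψ : L →+ P} {ι κ μ : Type*} {J : Finset (Fin q)} {c c' : ℤ}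
  {d : ι → P} {δ : κ → P} {ε : μ → P}

/-- The lattice points of degree `p` on which the functionals `l j` vanish for `j ∈ J` and are at
least `c` for `j ∉ J`. -/
def levelSet (l : Fin q → L →+ ℤ) (ψ : L →+ P) (J : Finset (Fin q)) (c : ℤ) (p : P) : Set L :=
  {s | (∀ j ∈ J, l j s = 0) ∧ (∀ j ∉ J, c ≤ l j s) ∧ ψ s = p}

lemma mul_mem_levelSet {e : ℤ} {a b p : P} (he : e ≤ c + c') (hp : a + b = p)
    {x y : AddMonoidAlgebra R L} (hx : x ∈ supportedOn R (levelSet l ψ J c a))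
    (hy : y ∈ supportedOn R (levelSet l ψ J c' b)) :
    x * y ∈ supportedOn R (levelSet l ψ J e p) := by
  refine mul_mem_supportedOn ?_ hx hy
  rintro s ⟨ha1, ha2, ha3⟩ t ⟨hb1, hb2, hb3⟩
  refine ⟨fun j hj => ?_, fun j hj => ?_, by rw [map_add, ha3, hb3, hp]⟩
  · rw [map_add, ha1 j hj, hb1 j hj, add_zero]
  · rw [map_add]
    exact he.trans (add_le_add (ha2 j hj) (hb2 j hj))

/-- A matrix over `R[L]` is graded of level `c`, with row degrees `d` and column degrees `δ`, if its
`(i, k)` entry is supported on lattice points of level `c` and degree `d i - δ k`. -/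
def IsGradedMatrix (l : Fin q → L →+ ℤ) (ψ : L →+ P) (J : Finset (Fin q)) (c : ℤ)
    (d : ι → P) (δ : κ → P) (X : Matrix ι κ (AddMonoidAlgebra R L)) : Prop :=
  ∀ i k, X i k ∈ supportedOn R (levelSet l ψ J c (d i - δ k))

namespace IsGradedMatrix

lemma mono {X : Matrix ι κ (AddMonoidAlgebra R L)} (hX : IsGradedMatrix l ψ J c d δ X)
    (h : c' ≤ c) : IsGradedMatrix l ψ J c' d δ X := fun i k =>
  supportedOn_mono (hX i k) fun _ hs => ⟨hs.1, fun j hj => h.trans (hs.2.1 j hj), hs.2.2⟩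

lemma zero : IsGradedMatrix l ψ J c d δ (0 : Matrix ι κ (AddMonoidAlgebra R L)) :=
  fun _ _ => Submodule.zero_mem _

lemma add {X Y : Matrix ι κ (AddMonoidAlgebra R L)} (hX : IsGradedMatrix l ψ J c d δ X)
    (hY : IsGradedMatrix l ψ J c d δ Y) : IsGradedMatrix l ψ J c d δ (X + Y) :=
  fun i k => Submodule.add_mem _ (hX i k) (hY i k)

lemma sub {X Y : Matrix ι κ (AddMonoidAlgebra R L)} (hX : IsGradedMatrix l ψ J c d δ X)
    (hY : IsGradedMatrix l ψ J c d δ Y) : IsGradedMatrix l ψ J c d δ (X - Y) :=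
  fun i k => Submodule.sub_mem _ (hX i k) (hY i k)

lemma sum {α : Type*} (s : Finset α) {X : α → Matrix ι κ (AddMonoidAlgebra R L)}
    (hX : ∀ a ∈ s, IsGradedMatrix l ψ J c d δ (X a)) :
    IsGradedMatrix l ψ J c d δ (∑ a ∈ s, X a) := fun i k => by
  rw [Matrix.sum_apply]
  exact Submodule.sum_mem _ fun a ha => hX a ha i k

lemma mul' [Fintype κ] {X : Matrix ι κ (AddMonoidAlgebra R L)}
    {Y : Matrix κ μ (AddMonoidAlgebra R L)} {e : ℤ} (he : e ≤ c + c')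
    (hX : IsGradedMatrix l ψ J c d δ X) (hY : IsGradedMatrix l ψ J c' δ ε Y) :
    IsGradedMatrix l ψ J e d ε (X * Y) := fun i k => by
  rw [Matrix.mul_apply]
  exact Submodule.sum_mem _ fun j _ => mul_mem_levelSet he (by abel) (hX i j) (hY j k)

lemma mul [Fintype κ] {X : Matrix ι κ (AddMonoidAlgebra R L)}
    {Y : Matrix κ μ (AddMonoidAlgebra R L)}
    (hX : IsGradedMatrix l ψ J c d δ X) (hY : IsGradedMatrix l ψ J c' δ ε Y) :
    IsGradedMatrix l ψ J (c + c') d ε (X * Y) := mul' le_rfl hX hY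

lemma mul_zero_level [Fintype κ] {X : Matrix ι κ (AddMonoidAlgebra R L)}
    {Y : Matrix κ μ (AddMonoidAlgebra R L)}
    (hX : IsGradedMatrix l ψ J 0 d δ X) (hY : IsGradedMatrix l ψ J 0 δ ε Y) :
    IsGradedMatrix l ψ J 0 d ε (X * Y) := mul' (by simp) hX hY

lemma one [DecidableEq ι] :
    IsGradedMatrix l ψ J 0 d d (1 : Matrix ι ι (AddMonoidAlgebra R L)) := fun i k => by
  rw [Matrix.one_apply]
  split_ifs with h
  · subst h
    rw [AddMonoidAlgebra.one_def]
    refine single_mem_supportedOn (X := levelSet l ψ J 0 (d i - d i)) ?_ _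
    exact ⟨by simp, by simp, by simp⟩
  · exact Submodule.zero_mem _

lemma pow [Fintype ι] [DecidableEq ι] {X : Matrix ι ι (AddMonoidAlgebra R L)}
    (hX : IsGradedMatrix l ψ J 1 d d X) (n : ℕ) : IsGradedMatrix l ψ J n d d (X ^ n) := by
  induction n with
  | zero => simpa using one
  | succ n ih => rw [pow_succ]; exact mul' (by simp) ih hX

lemma pow_zero_level [Fintype ι] [DecidableEq ι] {X : Matrix ι ι (AddMonoidAlgebra R L)}
    (hX : IsGradedMatrix l ψ J 0 d d X) (n : ℕ) : IsGradedMatrix l ψ J 0 d d (X ^ n) := by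
  induction n with
  | zero => simpa using one
  | succ n ih => rw [pow_succ]; exact mul_zero_level ih hX

lemma nonneg {X : Matrix ι κ (AddMonoidAlgebra R L)} (hX : IsGradedMatrix l ψ J 0 d δ X)
    (j : Fin q) (i : ι) (k : κ) : X i k ∈ supportedOn R {s | 0 ≤ l j s} :=
  supportedOn_mono (hX i k) fun s hs => by
    by_cases h : j ∈ J
    · exact (hs.1 j h).ge
    · exact hs.2.1 j h

lemma of_insert {j : Fin q} {X : Matrix ι κ (AddMonoidAlgebra R L)}
    (hX : IsGradedMatrix l ψ (insert j J) 0 d δ X) : IsGradedMatrix l ψ J 0 d δ X := fun i k =>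
  supportedOn_mono (hX i k) fun s hs =>
    ⟨fun a ha => hs.1 a (Finset.mem_insert_of_mem ha), fun a ha => by
      by_cases h : a = j
      · exact (hs.1 a (h ▸ Finset.mem_insert_self _ _)).ge
      · exact hs.2.1 a (by simp [h, ha]), hs.2.2⟩

lemma map_faceProj {f : L →+ ℤ} {X : Matrix ι κ (AddMonoidAlgebra R L)}
    (hX : IsGradedMatrix l ψ J c d δ X) : IsGradedMatrix l ψ J c d δ (X.map (faceProj R f)) :=
  fun i k => supportedOn_mono (faceProj_mem f (hX i k)) fun _ hs => hs.1

lemma map_faceProj_insert {j : Fin q} {X : Matrix ι κ (AddMonoidAlgebra R L)}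
    (hX : IsGradedMatrix l ψ J 0 d δ X) :
    IsGradedMatrix l ψ (insert j J) 0 d δ (X.map (faceProj R (l j))) := fun i k => by
  refine supportedOn_mono (faceProj_mem (l j) (hX i k)) ?_
  rintro s ⟨⟨h1, h2, h3⟩, h4⟩
  refine ⟨fun a ha => ?_, fun a ha => h2 a fun h => ha (Finset.mem_insert_of_mem h), h3⟩
  rcases Finset.mem_insert.1 ha with rfl | h
  · exact h4
  · exact h1 a h

lemma map_faceProj_univ {X : Matrix ι κ (AddMonoidAlgebra R L)}
    (hX : IsGradedMatrix l ψ J 0 d δ X) :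
    IsGradedMatrix l ψ Finset.univ 0 d δ (X.map (faceProj R (∑ j, l j))) := fun i k => by
  refine supportedOn_mono (faceProj_mem _ (hX i k)) ?_
  rintro s ⟨⟨h1, h2, h3⟩, h4⟩
  have h0 : ∀ j, 0 ≤ l j s := fun j => by
    by_cases h : j ∈ J
    · exact (h1 j h).ge
    · exact h2 j h
  refine ⟨fun j hj => ?_, by simp, h3⟩
  have h5 : ∑ j, l j s = 0 := by simpa using h4
  exact (Finset.sum_eq_zero_iff_of_nonneg fun j _ => h0 j).1 h5 j hj

lemma map_faceProj_eq_self {j : Fin q} (hj : j ∈ J) {X : Matrix ι κ (AddMonoidAlgebra R L)}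
    (hX : IsGradedMatrix l ψ J c d δ X) : X.map (faceProj R (l j)) = X := by
  ext1 i k
  exact faceProj_eq_self (supportedOn_mono (hX i k) fun s hs => hs.1 j hj)

lemma map_faceProj_univ_eq_self {X : Matrix ι κ (AddMonoidAlgebra R L)}
    (hX : IsGradedMatrix l ψ Finset.univ c d δ X) : X.map (faceProj R (∑ j, l j)) = X := by
  ext1 i k
  refine faceProj_eq_self (supportedOn_mono (hX i k) fun s hs => ?_)
  simpa using Finset.sum_eq_zero fun j hj => hs.1 j hj

lemma map_faceProj_eq_zero {j : Fin q} (hj : j ∉ J) {X : Matrix ι κ (AddMonoidAlgebra R L)}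
    (hX : IsGradedMatrix l ψ J 1 d δ X) : X.map (faceProj R (l j)) = 0 := by
  ext1 i k
  refine faceProj_eq_zero (supportedOn_mono (hX i k) fun s hs => ?_)
  have := hs.2.1 j hj
  simp only [Set.mem_ofPred_eq]
  lia

lemma of_map_faceProj_eq_zero {X : Matrix ι κ (AddMonoidAlgebra R L)}
    (hX : IsGradedMatrix l ψ J 0 d δ X) (h : ∀ j ∉ J, X.map (faceProj R (l j)) = 0) :
    IsGradedMatrix l ψ J 1 d δ X := fun i k s hs => by
  obtain ⟨h1, h2, h3⟩ := hX i k s hs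
  refine ⟨h1, fun j hj => ?_, h3⟩
  have h4 := ne_zero_of_faceProj_eq_zero (congrFun (congrFun (h j hj) i) k) s hs
  have h5 := h2 j hj
  simp only [Set.mem_ofPred_eq] at h4
  lia

lemma map_faceProj_mul [Fintype κ] {X : Matrix ι κ (AddMonoidAlgebra R L)}
    {Y : Matrix κ μ (AddMonoidAlgebra R L)} (j : Fin q)
    (hX : IsGradedMatrix l ψ J 0 d δ X) (hY : IsGradedMatrix l ψ J 0 δ ε Y) :
    (X * Y).map (faceProj R (l j)) = X.map (faceProj R (l j)) * Y.map (faceProj R (l j)) := by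
  ext1 i k
  simp only [Matrix.map_apply, Matrix.mul_apply, map_sum]
  exact Finset.sum_congr rfl fun a _ => faceProj_mul (hX.nonneg j i a) (hY.nonneg j a k)

lemma map_faceProj_univ_mul [Fintype κ] {X : Matrix ι κ (AddMonoidAlgebra R L)}
    {Y : Matrix κ μ (AddMonoidAlgebra R L)}
    (hX : IsGradedMatrix l ψ J 0 d δ X) (hY : IsGradedMatrix l ψ J 0 δ ε Y) :
    (X * Y).map (faceProj R (∑ j, l j)) =
      X.map (faceProj R (∑ j, l j)) * Y.map (faceProj R (∑ j, l j)) := by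
  ext1 i k
  simp only [Matrix.map_apply, Matrix.mul_apply, map_sum]
  refine Finset.sum_congr rfl fun a _ => faceProj_mul ?_ ?_
  · intro s hs
    simpa using Finset.sum_nonneg fun j _ => hX.nonneg j i a s hs
  · intro s hs
    simpa using Finset.sum_nonneg fun j _ => hY.nonneg j a k s hs

end IsGradedMatrix

lemma map_faceProj_one [DecidableEq ι] (f : L →+ ℤ) :
    (1 : Matrix ι ι (AddMonoidAlgebra R L)).map (faceProj R f) = 1 := by
  ext1 i k
  simp only [Matrix.map_apply, Matrix.one_apply]
  split_ifs <;> simp [faceProj_one]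

lemma map_faceProj_comm (f g : L →+ ℤ) (X : Matrix ι κ (AddMonoidAlgebra R L)) :
    (X.map (faceProj R f)).map (faceProj R g) = (X.map (faceProj R g)).map (faceProj R f) := by
  ext1 i k
  exact faceProj_comm g f _

lemma map_faceProj_sub (f : L →+ ℤ) (X Y : Matrix ι κ (AddMonoidAlgebra R L)) :
    (X - Y).map (faceProj R f) = X.map (faceProj R f) - Y.map (faceProj R f) := by
  ext1 i k
  exact map_sub (faceProj R f) _ _

lemma map_faceProj_add (f : L →+ ℤ) (X Y : Matrix ι κ (AddMonoidAlgebra R L)) :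
    (X + Y).map (faceProj R f) = X.map (faceProj R f) + Y.map (faceProj R f) := by
  ext1 i k
  exact map_add (faceProj R f) _ _

lemma map_faceProj_idem (f : L →+ ℤ) (X : Matrix ι κ (AddMonoidAlgebra R L)) :
    (X.map (faceProj R f)).map (faceProj R f) = X.map (faceProj R f) := by
  ext1 i k
  exact faceProj_eq_self (supportedOn_mono
    (faceProj_mem (X := Set.univ) _ fun _ _ => trivial) fun s hs => hs.2)

/-- A splitting of the idempotent matrix `E` by graded matrices of level `c`. -/
structure IsGradedSplitting [Fintype ι] [Fintype κ] [DecidableEq κ] (l : Fin q → L →+ ℤ)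
    (ψ : L →+ P) (J : Finset (Fin q)) (c : ℤ) (d : ι → P) (δ : κ → P)
    (E : Matrix ι ι (AddMonoidAlgebra R L)) (X : Matrix ι κ (AddMonoidAlgebra R L))
    (Y : Matrix κ ι (AddMonoidAlgebra R L)) : Prop where
  left : IsGradedMatrix l ψ J c d δ X
  right : IsGradedMatrix l ψ J c δ d Y
  mul_eq : X * Y = E
  mul_eq_one : Y * X = 1

lemma IsGradedSplitting.change [Fintype ι] [Fintype κ] [DecidableEq κ]
    {E : Matrix ι ι (AddMonoidAlgebra R L)} {X : Matrix ι κ (AddMonoidAlgebra R L)}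
    {Y : Matrix κ ι (AddMonoidAlgebra R L)} (h : IsGradedSplitting l ψ J c d δ E X Y)
    {γ γ' : Matrix κ κ (AddMonoidAlgebra R L)} (hγ : IsGradedMatrix l ψ J 0 δ δ γ)
    (hγ' : IsGradedMatrix l ψ J 0 δ δ γ') (h1 : γ * γ' = 1) (h2 : γ' * γ = 1) :
    IsGradedSplitting l ψ J c d δ E (X * γ') (γ * Y) where
  left := h.left.mul' (by simp) hγ'
  right := hγ.mul' (by simp) h.right
  mul_eq := by rw [Matrix.mul_assoc, ← Matrix.mul_assoc γ', h2, Matrix.one_mul, h.mul_eq]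
  mul_eq_one := by
    rw [Matrix.mul_assoc, ← Matrix.mul_assoc Y, h.mul_eq_one, Matrix.one_mul, h1]

end GradedMatrices

section Gluing

variable {R L P : Type*} [CommRing R] [AddCommGroup L] [AddCommGroup P] {q : ℕ}
  {l : Fin q → L →+ ℤ} {ψ : L →+ P} {ι κ : Type*} [Fintype ι] [DecidableEq ι] [Fintype κ]
  [DecidableEq κ] {J : Finset (Fin q)} {d : ι → P} {δ : κ → P}

/-- Automorphisms of a graded free module over finitely many faces that come from a common
endomorphism lift to an automorphism. -/
lemma exists_lift_automorphism (F : Finset (Fin q)) {α α' : Matrix κ κ (AddMonoidAlgebra R L)}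
    (hα : IsGradedMatrix l ψ J 0 δ δ α) (hα' : IsGradedMatrix l ψ J 0 δ δ α')
    (h : ∀ t ∈ F, (α * α').map (faceProj R (l t)) = 1)
    (h' : ∀ t ∈ F, (α' * α).map (faceProj R (l t)) = 1) :
    ∃ β β' : Matrix κ κ (AddMonoidAlgebra R L), IsGradedMatrix l ψ J 0 δ δ β ∧
      IsGradedMatrix l ψ J 0 δ δ β' ∧ β * β' = 1 ∧ β' * β = 1 ∧
      ∀ t ∈ F, β.map (faceProj R (l t)) = α.map (faceProj R (l t)) ∧
        β'.map (faceProj R (l t)) = α'.map (faceProj R (l t)) := by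
  induction F using Finset.induction_on with
  | empty => exact ⟨1, 1, .one, .one, by simp, by simp, by simp⟩
  | insert j F hj ih =>
    obtain ⟨β, β', hβ, hβ', h1, h2, h3⟩ := ih (fun t ht => h t (Finset.mem_insert_of_mem ht))
      (fun t ht => h' t (Finset.mem_insert_of_mem ht))
    have hj1 := h j (Finset.mem_insert_self _ _)
    have hj2 := h' j (Finset.mem_insert_self _ _)
    have e1 : β.map (faceProj R (l j)) * β'.map (faceProj R (l j)) = 1 := by
      rw [← hβ.map_faceProj_mul j hβ', h1, map_faceProj_one]
    have e2 : β'.map (faceProj R (l j)) * β.map (faceProj R (l j)) = 1 := by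
      rw [← hβ'.map_faceProj_mul j hβ, h2, map_faceProj_one]
    have e3 := hα.map_faceProj_mul j hα'
    have e4 := hα'.map_faceProj_mul j hα
    rw [hj1] at e3
    rw [hj2] at e4
    have m1 := hβ'.mul_zero_level hα
    have m2 := hα'.mul_zero_level hβ
    have n1 := hβ'.map_faceProj_mul j hα
    have n2 := hα'.map_faceProj_mul j hβ
    refine ⟨β * (β' * α).map (faceProj R (l j)), (α' * β).map (faceProj R (l j)) * β',
      hβ.mul_zero_level m1.map_faceProj, m2.map_faceProj.mul_zero_level hβ', ?_, ?_, ?_⟩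
    · rw [n1, n2]
      calc _ = β * (β'.map (faceProj R (l j)) * (α.map (faceProj R (l j)) *
            α'.map (faceProj R (l j))) * β.map (faceProj R (l j))) * β' := by
            simp only [Matrix.mul_assoc]
        _ = 1 := by rw [← e3, Matrix.mul_one, e2, Matrix.mul_one, h1]
    · rw [n1, n2]
      calc _ = α'.map (faceProj R (l j)) * (β.map (faceProj R (l j)) * ((β' * β) *
            β'.map (faceProj R (l j)))) * α.map (faceProj R (l j)) := by
            simp only [Matrix.mul_assoc]
        _ = 1 := by rw [h2, Matrix.one_mul, e1, Matrix.mul_one, ← e4]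
    · intro t ht
      rw [hβ.map_faceProj_mul t m1.map_faceProj, m2.map_faceProj.map_faceProj_mul t hβ']
      by_cases htj : t = j
      · subst htj
        rw [map_faceProj_idem, map_faceProj_idem, n1, n2, ← Matrix.mul_assoc, e1, Matrix.one_mul,
          Matrix.mul_assoc, e1,
          Matrix.mul_one]
        exact ⟨rfl, rfl⟩
      · have htF : t ∈ F := (Finset.mem_insert.1 ht).resolve_left htj
        obtain ⟨h4, h5⟩ := h3 t htF
        rw [map_faceProj_comm (l j) (l t), map_faceProj_comm (l j) (l t),
          hβ'.map_faceProj_mul t hα, hα'.map_faceProj_mul t hβ, h4, h5,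
          ← hα'.map_faceProj_mul t hα, h' t ht, map_faceProj_one, Matrix.mul_one, Matrix.one_mul]
        exact ⟨rfl, rfl⟩

end Gluing

section Glued

variable {R L P : Type*} [CommRing R] [AddCommGroup L] [AddCommGroup P] {q : ℕ}
  {l : Fin q → L →+ ℤ} {ψ : L →+ P} {ι κ : Type*} [Fintype ι] [Fintype κ]
  [DecidableEq κ] {J : Finset (Fin q)} {d : ι → P} {δ : κ → P}

/-- Splittings of a graded idempotent over the facets of a face glue to a pair of maps that is a
splitting modulo the interior of the face. -/
lemma exists_glued {E : Matrix ι ι (AddMonoidAlgebra R L)} (hE : IsGradedMatrix l ψ J 0 d d E)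
    (hEE : E * E = E)
    (hX : ∀ j ∉ J, ∃ (X : Matrix ι κ (AddMonoidAlgebra R L))
      (Y : Matrix κ ι (AddMonoidAlgebra R L)),
        IsGradedSplitting l ψ (insert j J) 0 d δ (E.map (faceProj R (l j))) X Y)
    (F : Finset (Fin q)) (hF : ∀ t ∈ F, t ∉ J) :
    ∃ (f : Matrix ι κ (AddMonoidAlgebra R L)) (f' : Matrix κ ι (AddMonoidAlgebra R L)),
      IsGradedMatrix l ψ J 0 d δ f ∧ IsGradedMatrix l ψ J 0 δ d f' ∧ E * f = f ∧ f' * E = f' ∧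
        ∀ t ∈ F, (f' * f).map (faceProj R (l t)) = 1 ∧
          (f * f').map (faceProj R (l t)) = E.map (faceProj R (l t)) := by
  induction F using Finset.induction_on with
  | empty => exact ⟨0, 0, .zero, .zero, by simp, by simp, by simp⟩
  | insert j F hj ih =>
    obtain ⟨f, f', hf, hf', h1, h2, h3⟩ := ih fun t ht => hF t (Finset.mem_insert_of_mem ht)
    obtain ⟨X, Y, hXg, hYg, hXY, hYX⟩ := hX j (hF j (Finset.mem_insert_self _ _))
    have hfj := hf.map_faceProj_insert (j := j)
    have hfj' := hf'.map_faceProj_insert (j := j)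
    have hEj := hE.map_faceProj_insert (j := j)
    have hα := hYg.mul_zero_level hfj
    have hα' := hfj'.mul_zero_level hXg
    have EX : E.map (faceProj R (l j)) * X = X := by
      rw [← hXY, Matrix.mul_assoc, hYX, Matrix.mul_one]
    have YE : Y * E.map (faceProj R (l j)) = Y := by
      rw [← hXY, ← Matrix.mul_assoc, hYX, Matrix.one_mul]
    have Ef : E.map (faceProj R (l j)) * f.map (faceProj R (l j)) = f.map (faceProj R (l j)) := by
      rw [← hE.map_faceProj_mul j hf, h1]
    have fE : f'.map (faceProj R (l j)) * E.map (faceProj R (l j)) =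
        f'.map (faceProj R (l j)) := by
      rw [← hf'.map_faceProj_mul j hE, h2]
    have c1 : ∀ t ∈ F, (Y * f.map (faceProj R (l j)) * (f'.map (faceProj R (l j)) * X)).map
        (faceProj R (l t)) = 1 := by
      intro t ht
      rw [show Y * f.map (faceProj R (l j)) * (f'.map (faceProj R (l j)) * X) =
        Y * (f.map (faceProj R (l j)) * f'.map (faceProj R (l j))) * X by
          simp only [Matrix.mul_assoc], ← hf.map_faceProj_mul j hf',
        (hYg.mul_zero_level (hf.mul_zero_level hf').map_faceProj_insert).map_faceProj_mul t hXg,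
        hYg.map_faceProj_mul t (hf.mul_zero_level hf').map_faceProj_insert,
        map_faceProj_comm (l j), (h3 t ht).2, map_faceProj_comm (l t),
        ← hYg.map_faceProj_mul t hEj, YE, ← hYg.map_faceProj_mul t hXg, hYX, map_faceProj_one]
    have c2 : ∀ t ∈ F, (f'.map (faceProj R (l j)) * X * (Y * f.map (faceProj R (l j)))).map
        (faceProj R (l t)) = 1 := by
      intro t ht
      rw [show f'.map (faceProj R (l j)) * X * (Y * f.map (faceProj R (l j))) =
        f'.map (faceProj R (l j)) * (X * Y) * f.map (faceProj R (l j)) by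
          simp only [Matrix.mul_assoc], hXY, fE, ← hf'.map_faceProj_mul j hf,
        map_faceProj_comm, (h3 t ht).1, map_faceProj_one]
    obtain ⟨β, β', hβ, hβ', b1, b2, b3⟩ := exists_lift_automorphism F hα hα' c1 c2
    have hg := hXg.mul_zero_level hβ
    have hg' := hβ'.mul_zero_level hYg
    have gg' : X * β * (β' * Y) = E.map (faceProj R (l j)) := by
      rw [Matrix.mul_assoc, ← Matrix.mul_assoc β, b1, Matrix.one_mul, hXY]
    have g'g : β' * Y * (X * β) = 1 := by
      rw [Matrix.mul_assoc, ← Matrix.mul_assoc Y, hYX, Matrix.one_mul, b2]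
    have tg : ∀ t ∈ F, (X * β).map (faceProj R (l t)) =
        (f.map (faceProj R (l j))).map (faceProj R (l t)) := by
      intro t ht
      rw [hXg.map_faceProj_mul t hβ, (b3 t ht).1, ← hXg.map_faceProj_mul t hα,
        ← Matrix.mul_assoc, hXY, Ef]
    have tg' : ∀ t ∈ F, (β' * Y).map (faceProj R (l t)) =
        (f'.map (faceProj R (l j))).map (faceProj R (l t)) := by
      intro t ht
      rw [hβ'.map_faceProj_mul t hYg, (b3 t ht).2, ← hα'.map_faceProj_mul t hYg,
        Matrix.mul_assoc, hXY, fE]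
    have hs := (hf.add hg.of_insert).sub (hf.map_faceProj (f := l j))
    have hs' := (hf'.add hg'.of_insert).sub (hf'.map_faceProj (f := l j))
    have hh := hE.mul_zero_level hs
    have hh' := hs'.mul_zero_level hE
    have mj := hg.map_faceProj_eq_self (Finset.mem_insert_self j J)
    have mj' := hg'.map_faceProj_eq_self (Finset.mem_insert_self j J)
    have hj1 : (E * (f + X * β - f.map (faceProj R (l j)))).map (faceProj R (l j)) = X * β := by
      rw [hE.map_faceProj_mul j hs, map_faceProj_sub, map_faceProj_add, map_faceProj_idem, mj,
        add_sub_cancel_left, ← Matrix.mul_assoc, EX]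
    have hj2 : ((f' + β' * Y - f'.map (faceProj R (l j))) * E).map (faceProj R (l j)) =
        β' * Y := by
      rw [hs'.map_faceProj_mul j hE, map_faceProj_sub, map_faceProj_add, map_faceProj_idem, mj',
        add_sub_cancel_left, Matrix.mul_assoc, YE]
    have ht1 : ∀ t ∈ F, (E * (f + X * β - f.map (faceProj R (l j)))).map (faceProj R (l t)) =
        f.map (faceProj R (l t)) := by
      intro t ht
      rw [hE.map_faceProj_mul t hs, map_faceProj_sub, map_faceProj_add, tg t ht,
        add_sub_cancel_right, ← hE.map_faceProj_mul t hf, h1]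
    have ht2 : ∀ t ∈ F, ((f' + β' * Y - f'.map (faceProj R (l j))) * E).map (faceProj R (l t)) =
        f'.map (faceProj R (l t)) := by
      intro t ht
      rw [hs'.map_faceProj_mul t hE, map_faceProj_sub, map_faceProj_add, tg' t ht,
        add_sub_cancel_right, ← hf'.map_faceProj_mul t hE, h2]
    refine ⟨_, _, hh, hh', by rw [← Matrix.mul_assoc, hEE], by rw [Matrix.mul_assoc, hEE], ?_⟩
    intro t ht
    rw [hh'.map_faceProj_mul t hh, hh.map_faceProj_mul t hh']
    rcases Finset.mem_insert.1 ht with rfl | ht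
    · rw [hj1, hj2]
      exact ⟨g'g, gg'⟩
    · rw [ht1 t ht, ht2 t ht, ← hf'.map_faceProj_mul t hf, ← hf.map_faceProj_mul t hf']
      exact h3 t ht

end Glued

section Splitting

lemma exists_splitting_of_extended {R B : Type u} [CommRing R] [CommRing B] [Algebra R B]
    (hR : AllProjectiveFree R) (hB : AllFGProjectiveExtended R B) {ι : Type} [Fintype ι]
    [DecidableEq ι] {Ω : Matrix ι ι B} (hΩ : Ω * Ω = Ω) :
    ∃ (n : ℕ) (X : Matrix ι (Fin n) B) (Y : Matrix (Fin n) ι B), X * Y = Ω ∧ Y * X = 1 := by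
  let T := Matrix.toLin' Ω
  have hT : ∀ v : ↥(LinearMap.range T), T v = v := by
    rintro ⟨_, w, rfl⟩
    have : T ∘ₗ T = T := by rw [← Matrix.toLin'_mul, hΩ]
    exact LinearMap.congr_fun this w
  have hsplit : T.rangeRestrict ∘ₗ (LinearMap.range T).subtype = LinearMap.id := by
    ext1 v
    exact Subtype.ext (hT v)
  have hproj : Module.Projective B ↥(LinearMap.range T) := Module.Projective.of_split _ _ hsplit
  have hfin : Module.Finite B ↥(LinearMap.range T) := inferInstance
  obtain ⟨F, _, _, _, hF, ⟨e⟩⟩ := hB _ hfin hproj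
  have := hR F hF
  let b' := Module.Free.chooseBasis R F
  let n := Fintype.card (Module.Free.ChooseBasisIndex R F)
  let b : Module.Basis (Fin n) B ↥(LinearMap.range T) :=
    ((b'.baseChange B).map e.symm).reindex (Fintype.equivFin _)
  refine ⟨n, LinearMap.toMatrix' ((LinearMap.range T).subtype ∘ₗ b.equivFun.symm.toLinearMap),
    LinearMap.toMatrix' (b.equivFun.toLinearMap ∘ₗ T.rangeRestrict), ?_, ?_⟩
  · rw [← LinearMap.toMatrix'_comp]
    have : ((LinearMap.range T).subtype ∘ₗ b.equivFun.symm.toLinearMap) ∘ₗ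
        (b.equivFun.toLinearMap ∘ₗ T.rangeRestrict) = T := by
      refine LinearMap.ext fun v => ?_
      exact congrArg Subtype.val (b.equivFun.symm_apply_apply (T.rangeRestrict v))
    rw [this, LinearMap.toMatrix'_toLin']
  · rw [← LinearMap.toMatrix'_comp]
    have : (b.equivFun.toLinearMap ∘ₗ T.rangeRestrict) ∘ₗ
        ((LinearMap.range T).subtype ∘ₗ b.equivFun.symm.toLinearMap) = LinearMap.id := by
      refine LinearMap.ext fun v => ?_
      exact (congrArg b.equivFun (LinearMap.congr_fun hsplit (b.equivFun.symm v))).trans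
        (b.equivFun.apply_symm_apply v)
    rw [this, LinearMap.toMatrix'_id]

variable {R T L : Type*} [CommRing R] [AddCommMonoid T] [AddCommGroup L]

lemma mapDomain_mem_supportedOn (φ : T →+ L) (x : AddMonoidAlgebra R T) :
    AddMonoidAlgebra.mapDomainRingHom R φ x ∈ supportedOn R (Set.range φ) := by
  rw [sum_single_coeff x, map_sum]
  refine Submodule.sum_mem _ fun s _ => ?_
  simpa using single_mem_supportedOn (X := Set.range φ) ⟨s, rfl⟩ _

lemma exists_mapDomain_eq {φ : T →+ L} {x : AddMonoidAlgebra R L}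
    (hx : x ∈ supportedOn R (Set.range φ)) :
    ∃ y, AddMonoidAlgebra.mapDomainRingHom R φ y = x := by
  rw [sum_single_coeff x]
  change _ ∈ (AddMonoidAlgebra.mapDomainRingHom R φ).range
  refine Subring.sum_mem _ fun s hs => ?_
  obtain ⟨t, rfl⟩ := hx s (Finsupp.mem_support_iff.1 hs)
  exact ⟨.single t (x.coeff (φ t)), by simp⟩

lemma mapDomainRingHom_injective {φ : T →+ L} (hφ : Function.Injective φ) :
    Function.Injective (AddMonoidAlgebra.mapDomainRingHom R φ) :=
  AddMonoidAlgebra.mapDomain_injective hφ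

end Splitting

/-- Idempotent matrices supported on a submonoid split if projective modules over the algebra of
that submonoid are extended. -/
lemma exists_splitting_supportedOn {R T L : Type u} [CommRing R] [AddCommMonoid T]
    [AddCommGroup L] (hR : AllProjectiveFree R)
    (hT : AllFGProjectiveExtended R (AddMonoidAlgebra R T)) {φ : T →+ L}
    (hφ : Function.Injective φ) {ι : Type} [Fintype ι] [DecidableEq ι]
    {Ω : Matrix ι ι (AddMonoidAlgebra R L)} (hΩ : Ω * Ω = Ω)
    (hs : ∀ i k, Ω i k ∈ supportedOn R (Set.range φ)) :
    ∃ (n : ℕ) (X : Matrix ι (Fin n) (AddMonoidAlgebra R L))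
      (Y : Matrix (Fin n) ι (AddMonoidAlgebra R L)),
      (∀ i k, X i k ∈ supportedOn R (Set.range φ)) ∧
        (∀ i k, Y i k ∈ supportedOn R (Set.range φ)) ∧ X * Y = Ω ∧ Y * X = 1 := by
  choose Ω' hΩ' using fun i k => exists_mapDomain_eq (hs i k)
  let m := AddMonoidAlgebra.mapDomainRingHom R φ
  have hΩm : (Matrix.of Ω').map m = Ω := by
    ext1 i k
    exact hΩ' i k
  have hidem : Matrix.of Ω' * Matrix.of Ω' = Matrix.of Ω' := by
    apply Matrix.map_injective (mapDomainRingHom_injective hφ)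
    change (Matrix.of Ω' * Matrix.of Ω').map m = (Matrix.of Ω').map m
    rw [Matrix.map_mul, hΩm, hΩ]
  obtain ⟨n, X, Y, h1, h2⟩ := exists_splitting_of_extended hR hT hidem
  refine ⟨n, X.map m, Y.map m, fun i k => mapDomain_mem_supportedOn φ _,
    fun i k => mapDomain_mem_supportedOn φ _, ?_, ?_⟩
  · rw [← Matrix.map_mul, h1, hΩm]
  · rw [← Matrix.map_mul, h2, Matrix.map_one _ (map_zero _) (map_one _)]

section Approximation

variable {R L P : Type*} [CommRing R] [AddCommGroup L] [AddCommGroup P] {q : ℕ}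
  {l : Fin q → L →+ ℤ} {ψ : L →+ P} {ι κ : Type*} [Fintype ι] [DecidableEq ι] [Fintype κ]
  [DecidableEq κ] {J : Finset (Fin q)} {d : ι → P} {δ : κ → P}

/-- Splittings of a graded idempotent over the facets of a face glue to a map that is invertible up
to an error of arbitrarily high level. -/
lemma exists_glued_level {E : Matrix ι ι (AddMonoidAlgebra R L)}
    (hE : IsGradedMatrix l ψ J 0 d d E) (hEE : E * E = E)
    (hX : ∀ j ∉ J, ∃ (X : Matrix ι κ (AddMonoidAlgebra R L))
      (Y : Matrix κ ι (AddMonoidAlgebra R L)),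
        IsGradedSplitting l ψ (insert j J) 0 d δ (E.map (faceProj R (l j))) X Y) :
    ∃ f : Matrix ι κ (AddMonoidAlgebra R L), IsGradedMatrix l ψ J 0 d δ f ∧ E * f = f ∧
      ∀ N : ℕ, ∃ g : Matrix κ ι (AddMonoidAlgebra R L), IsGradedMatrix l ψ J 0 δ d g ∧
        g * E = g ∧ IsGradedMatrix l ψ J N δ δ (1 - g * f) ∧
          IsGradedMatrix l ψ J N d d (E - f * g) := by
  obtain ⟨f, f', hf, hf', h1, h2, h3⟩ := exists_glued hE hEE hX (Finset.univ \ J) (by simp)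
  have h3' : ∀ t ∉ J, _ := fun t ht => h3 t (by simpa using ht)
  refine ⟨f, hf, h1, fun N => ?_⟩
  have hZ : IsGradedMatrix l ψ J 1 δ δ (1 - f' * f) :=
    (IsGradedMatrix.one.sub (hf'.mul_zero_level hf)).of_map_faceProj_eq_zero fun t ht => by
      rw [map_faceProj_sub, map_faceProj_one, (h3' t ht).1, sub_self]
  have hW : IsGradedMatrix l ψ J 1 d d (E - f * f') :=
    (hE.sub (hf.mul_zero_level hf')).of_map_faceProj_eq_zero fun t ht => by
      rw [map_faceProj_sub, (h3' t ht).2, sub_self]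
  set Z := 1 - f' * f with hZdef
  set W := E - f * f' with hWdef
  have hff : f' * f = 1 - Z := by rw [hZdef, sub_sub_cancel]
  have hfZ : ∀ n : ℕ, f * Z ^ n = W ^ n * f := by
    have h0 : f * Z = W * f := by
      rw [hZdef, hWdef, Matrix.mul_sub, Matrix.sub_mul, h1, Matrix.mul_one, Matrix.mul_assoc]
    intro n
    induction n with
    | zero => simp
    | succ n ih => rw [pow_succ, ← Matrix.mul_assoc, ih, Matrix.mul_assoc, h0, ← Matrix.mul_assoc,
        ← pow_succ]
  have hWE : (1 - W) * E = E - W := by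
    rw [Matrix.sub_mul, Matrix.one_mul, hWdef, Matrix.sub_mul, hEE, Matrix.mul_assoc, h2]
  refine ⟨(∑ i ∈ Finset.range N, Z ^ i) * f', IsGradedMatrix.mul_zero_level
    (.sum _ fun i _ => (hZ.mono zero_le_one).pow_zero_level i) hf', ?_, ?_, ?_⟩
  · rw [Matrix.mul_assoc, h2]
  · rw [Matrix.mul_assoc, hff, geom_sum_mul_neg, sub_sub_cancel]
    exact hZ.pow N
  · have : f * ((∑ i ∈ Finset.range N, Z ^ i) * f') = E - W ^ N * E := by
      calc _ = (∑ i ∈ Finset.range N, W ^ i) * (f * f') := by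
            rw [← Matrix.mul_assoc, Matrix.mul_sum, Matrix.sum_mul, Matrix.sum_mul]
            exact Finset.sum_congr rfl fun i _ => by rw [hfZ, Matrix.mul_assoc]
        _ = (∑ i ∈ Finset.range N, W ^ i) * ((1 - W) * E) := by
            rw [hWE, hWdef, sub_sub_cancel]
        _ = E - W ^ N * E := by
            rw [← Matrix.mul_assoc, geom_sum_mul_neg, Matrix.sub_mul, Matrix.one_mul]
    rw [this, sub_sub_cancel]
    exact (hW.pow N).mul' (by simp) hE

end Approximation

section Levels

variable {R L P : Type*} [CommRing R] [AddCommGroup L] [AddCommGroup P] {q : ℕ}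
  {l : Fin q → L →+ ℤ} {ψ : L →+ P} {ι κ : Type*} {J : Finset (Fin q)} {d : ι → P} {δ : κ → P}

lemma exists_abs_le [Finite ι] (l : Fin q → L →+ ℤ) (n : ι → L) :
    ∃ a : ℕ, ∀ i c, |l c (n i)| ≤ a := by
  have : Fintype ι := Fintype.ofFinite ι
  refine ⟨∑ i, ∑ c, (l c (n i)).natAbs, fun i c => ?_⟩
  rw [Int.abs_eq_natAbs, Nat.cast_le]
  exact (Finset.single_le_sum (f := fun c => (l c (n i)).natAbs) (fun _ _ => zero_le)
    (Finset.mem_univ c)).trans (Finset.single_le_sum (f := fun i => ∑ c, (l c (n i)).natAbs)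
      (fun _ _ => zero_le) (Finset.mem_univ i))

lemma exists_isGradedMatrix [Finite ι] [Finite κ] {X : Matrix ι κ (AddMonoidAlgebra R L)}
    (hX : ∀ i k, X i k ∈ supportedOn R {s | (∀ j ∈ J, l j s = 0) ∧ ψ s = d i - δ k}) :
    ∃ a : ℕ, IsGradedMatrix l ψ J (-a) d δ X := by
  obtain ⟨a, ha⟩ := exists_abs_le (ι := Σ ik : ι × κ, (X ik.1 ik.2).coeff.support) l
    (fun x => (x.2 : L))
  refine ⟨a, fun i k s hs => ⟨(hX i k s hs).1, fun c _ => ?_, (hX i k s hs).2⟩⟩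
  exact (abs_le.1 (ha ⟨(i, k), ⟨s, Finsupp.mem_support_iff.2 hs⟩⟩ c)).1

/-- If the monoid of invariants has no point in the interior of a face, then graded matrices of
high level vanish. -/
lemma exists_level_eq_zero [Finite ι] [Finite κ] {p : P}
    (hm : ¬ ∃ m : L, (∀ c ∈ J, l c m = 0) ∧ (∀ c ∉ J, 1 ≤ l c m) ∧ ψ m = 0)
    {n : ι → L} (hn : ∀ i, ∀ c ∈ J, l c (n i) = 0) (hd : ∀ i, d i = p + ψ (n i))
    {ν : κ → L} (hν : ∀ k, ∀ c ∈ J, l c (ν k) = 0) (hδ : ∀ k, δ k = p + ψ (ν k)) :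
    ∃ N : ℕ, ∀ M : ℕ, N ≤ M → ∀ X : Matrix ι κ (AddMonoidAlgebra R L),
      IsGradedMatrix l ψ J M d δ X → X = 0 := by
  obtain ⟨a, ha⟩ := exists_abs_le l n
  obtain ⟨b, hb⟩ := exists_abs_le l ν
  refine ⟨a + b + 1, fun M hM X hX => ?_⟩
  ext i k s
  by_contra hs
  obtain ⟨h1, h2, h3⟩ := hX i k s hs
  refine hm ⟨s - n i + ν k, fun c hc => ?_, fun c hc => ?_, ?_⟩
  · simp [h1 c hc, hn i c hc, hν k c hc]
  · have h4 := abs_le.1 (ha i c)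
    have h5 := abs_le.1 (hb k c)
    have h6 := h2 c hc
    rw [map_add, map_sub]
    lia
  · rw [map_add, map_sub, h3, hd, hδ]
    abel

lemma IsGradedMatrix.diagonal_single [DecidableEq ι] {a : ℕ} {p : P} {n : ι → L}
    (ha : ∀ i c, |l c (n i)| ≤ a) (hn : ∀ i, ∀ c ∈ J, l c (n i) = 0)
    (hd : ∀ i, d i = p + ψ (n i)) :
    IsGradedMatrix l ψ J (-a) d (fun _ => p)
      (Matrix.diagonal fun i => (AddMonoidAlgebra.single (n i) (1 : R))) := fun i k => by
  by_cases h : i = k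
  · subst h
    rw [Matrix.diagonal_apply_eq]
    refine single_mem_supportedOn (X := levelSet l ψ J (-a) (d i - p)) ?_ _
    exact ⟨hn i, fun c _ => (abs_le.1 (ha i c)).1, by rw [hd]; abel⟩
  · rw [Matrix.diagonal_apply_ne _ h]
    exact Submodule.zero_mem _

lemma IsGradedMatrix.diagonal_single_neg [DecidableEq ι] {a : ℕ} {p : P} {n : ι → L}
    (ha : ∀ i c, |l c (n i)| ≤ a) (hn : ∀ i, ∀ c ∈ J, l c (n i) = 0)
    (hd : ∀ i, d i = p + ψ (n i)) :
    IsGradedMatrix l ψ J (-a) (fun _ => p) d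
      (Matrix.diagonal fun i => (AddMonoidAlgebra.single (-n i) (1 : R))) := fun i k => by
  by_cases h : i = k
  · subst h
    rw [Matrix.diagonal_apply_eq]
    refine single_mem_supportedOn (X := levelSet l ψ J (-a) (p - d i)) ?_ _
    refine ⟨fun c hc => by simp [hn i c hc], fun c _ => ?_, by rw [hd, map_neg]; abel⟩
    rw [map_neg]
    exact neg_le_neg (abs_le.1 (ha i c)).2
  · rw [Matrix.diagonal_apply_ne _ h]
    exact Submodule.zero_mem _

lemma diagonal_single_mul_neg [Fintype ι] [DecidableEq ι] (n : ι → L) :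
    (Matrix.diagonal fun i => (AddMonoidAlgebra.single (n i) (1 : R))) *
      (Matrix.diagonal fun i => (AddMonoidAlgebra.single (-n i) (1 : R))) = 1 := by
  rw [Matrix.diagonal_mul_diagonal]
  simp [AddMonoidAlgebra.single_mul_single, ← AddMonoidAlgebra.one_def]

lemma diagonal_single_neg_mul [Fintype ι] [DecidableEq ι] (n : ι → L) :
    (Matrix.diagonal fun i => (AddMonoidAlgebra.single (-n i) (1 : R))) *
      (Matrix.diagonal fun i => (AddMonoidAlgebra.single (n i) (1 : R))) = 1 := by
  rw [Matrix.diagonal_mul_diagonal]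
  simp [AddMonoidAlgebra.single_mul_single, ← AddMonoidAlgebra.one_def]

end Levels

section Triangular

variable {R L P : Type*} [CommRing R] [AddCommGroup L] [AddCommGroup P] {q : ℕ}
  {l : Fin q → L →+ ℤ} {ψ : L →+ P} {κ μ : Type*} {J : Finset (Fin q)}
  {δ : κ → P}

/-- The strictly upper triangular part of a matrix with respect to a rank function. -/
def upperPart {α : Type*} [Zero α] (rk : κ → ℕ) (Z : Matrix κ κ α) : Matrix κ κ α :=
  Matrix.of fun i j => if rk i < rk j then Z i j else 0

lemma upperPart_apply {α : Type*} [Zero α] (rk : κ → ℕ) (Z : Matrix κ κ α) (i j : κ) :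
    upperPart rk Z i j = if rk i < rk j then Z i j else 0 := rfl

lemma IsGradedMatrix.upper {c : ℤ} {Z : Matrix κ κ (AddMonoidAlgebra R L)}
    (rk : κ → ℕ) (hZ : IsGradedMatrix l ψ J c δ δ Z) :
    IsGradedMatrix l ψ J c δ δ (upperPart rk Z) :=
  fun i k => by
    rw [upperPart_apply]
    split_ifs
    · exact hZ i k
    · exact Submodule.zero_mem _

lemma upperPart_sub {α : Type*} [AddGroup α] (rk : κ → ℕ) (Y Z : Matrix κ κ α) :
    upperPart rk (Y - Z) = upperPart rk Y - upperPart rk Z := by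
  ext1 i j
  simp only [upperPart_apply, Matrix.sub_apply]
  split_ifs <;> simp

lemma upperPart_upperPart {α : Type*} [Zero α] (rk : κ → ℕ) (Z : Matrix κ κ α) :
    upperPart rk (upperPart rk Z) = upperPart rk Z := by
  ext1 i j
  simp only [upperPart_apply]
  split_ifs <;> rfl

lemma upperPart_one {α : Type*} [Zero α] [One α] [DecidableEq κ] (rk : κ → ℕ) :
    upperPart rk (1 : Matrix κ κ α) = 0 := by
  ext1 i j
  rw [upperPart_apply]
  split_ifs with h
  · exact Matrix.one_apply_ne fun hij => h.ne (congrArg rk hij)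
  · rfl

variable [Fintype κ]

lemma toCols₂_mul {α : Type*} [NonUnitalNonAssocSemiring α] (A : Matrix κ κ α)
    (B : Matrix κ (μ ⊕ κ) α) : (A * B).toCols₂ = A * B.toCols₂ := rfl

lemma IsGradedMatrix.upper_mul {s t e : ℤ} {rk : κ → ℕ}
    {H Z : Matrix κ κ (AddMonoidAlgebra R L)} (hH : IsGradedMatrix l ψ J 0 δ δ H)
    (hHt : IsGradedMatrix l ψ J t δ δ (upperPart rk H)) (hZ : IsGradedMatrix l ψ J 1 δ δ Z)
    (hZs : IsGradedMatrix l ψ J s δ δ (upperPart rk Z)) (he : e ≤ s) (he' : e ≤ t + 1) :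
    IsGradedMatrix l ψ J e δ δ (upperPart rk (H * Z)) := by
  intro i j
  rw [upperPart_apply]
  split_ifs with hij
  · rw [Matrix.mul_apply]
    refine Submodule.sum_mem _ fun k _ => ?_
    by_cases hk : rk k < rk j
    · have := hZs k j
      rw [upperPart_apply, if_pos hk] at this
      exact mul_mem_levelSet (by simpa using he) (by abel) (hH i k) this
    · have := hHt i k
      rw [upperPart_apply, if_pos (by lia)] at this
      exact mul_mem_levelSet he' (by abel) this (hZ k j)
  · exact Submodule.zero_mem _

variable [DecidableEq κ]

lemma exists_upperPart_pow_eq_zero {α : Type*} [Semiring α] (rk : κ → ℕ) (Z : Matrix κ κ α) :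
    ∃ n : ℕ, upperPart rk Z ^ n = 0 := by
  have key : ∀ n : ℕ, ∀ i j, (upperPart rk Z ^ n) i j ≠ 0 → rk i + n ≤ rk j := by
    intro n
    induction n with
    | zero =>
      intro i j h
      rw [pow_zero, Matrix.one_apply] at h
      simp only [ne_eq, ite_eq_right_iff, not_forall] at h
      rw [h.1, add_zero]
    | succ n ih =>
      intro i j h
      rw [pow_succ, Matrix.mul_apply] at h
      obtain ⟨k, -, hk⟩ := Finset.exists_ne_zero_of_sum_ne_zero h
      have h1 := ih i k (left_ne_zero_of_mul hk)
      have h2 : rk k < rk j := by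
        by_contra h3
        exact right_ne_zero_of_mul hk (by rw [upperPart_apply, if_neg h3])
      lia
  refine ⟨∑ i, rk i + 1, ?_⟩
  ext1 i j
  by_contra h
  have h1 := key _ i j h
  have h2 := Finset.single_le_sum (f := rk) (fun _ _ => zero_le) (Finset.mem_univ j)
  lia

/-- A splitting can be changed so that the strictly upper triangular parts of its blocks have high
level. -/
lemma exists_triangular_splitting [Fintype μ] {p : P}
    {Ω : Matrix (μ ⊕ κ) (μ ⊕ κ) (AddMonoidAlgebra R L)}
    {X : Matrix (μ ⊕ κ) κ (AddMonoidAlgebra R L)} {Y : Matrix κ (μ ⊕ κ) (AddMonoidAlgebra R L)}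
    (h : IsGradedSplitting l ψ J 0 (fun _ => p) (fun _ => p) Ω X Y)
    (hu : ∀ t ∉ J, (Y.toCols₂ * X.toRows₂).map (faceProj R (l t)) = 1) {s : ℕ} (hs : 1 ≤ s)
    (hΩ : IsGradedMatrix l ψ J s (fun _ => p) (fun _ => p) (1 - Ω.toBlocks₂₂)) (rk : κ → ℕ) :
    ∃ (X : Matrix (μ ⊕ κ) κ (AddMonoidAlgebra R L))
      (Y : Matrix κ (μ ⊕ κ) (AddMonoidAlgebra R L)),
      IsGradedSplitting l ψ J 0 (fun _ => p) (fun _ => p) Ω X Y ∧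
        IsGradedMatrix l ψ J s (fun _ => p) (fun _ => p) (upperPart rk X.toRows₂) ∧
        IsGradedMatrix l ψ J s (fun _ => p) (fun _ => p) (upperPart rk Y.toCols₂) := by
  have blocks : ∀ {X : Matrix (μ ⊕ κ) κ (AddMonoidAlgebra R L)}
      {Y : Matrix κ (μ ⊕ κ) (AddMonoidAlgebra R L)},
      IsGradedSplitting l ψ J 0 (fun _ => p) (fun _ => p) Ω X Y →
      X.toRows₂ * Y.toCols₂ = Ω.toBlocks₂₂ := by
    intro X Y h
    rw [← h.mul_eq]
    rfl
  have hΩt : ∀ t ∉ J, Ω.toBlocks₂₂.map (faceProj R (l t)) = 1 := by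
    intro t ht
    have := (hΩ.mono (by exact_mod_cast hs)).map_faceProj_eq_zero ht
    rw [map_faceProj_sub, map_faceProj_one, sub_eq_zero] at this
    exact this.symm
  have base : ∃ (X : Matrix (μ ⊕ κ) κ (AddMonoidAlgebra R L))
      (Y : Matrix κ (μ ⊕ κ) (AddMonoidAlgebra R L)),
      IsGradedSplitting l ψ J 0 (fun _ => p) (fun _ => p) Ω X Y ∧
        IsGradedMatrix l ψ J 1 (fun _ => p) (fun _ => p) (Y.toCols₂ - 1) := by
    have hH : IsGradedMatrix l ψ J 0 (fun _ => p) (fun _ => p) Y.toCols₂ :=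
      fun i k => h.right i (Sum.inr k)
    have hH' : IsGradedMatrix l ψ J 0 (fun _ => p) (fun _ => p) X.toRows₂ :=
      fun i k => h.left (Sum.inr i) k
    obtain ⟨β, β', hβ, hβ', b1, b2, b3⟩ := exists_lift_automorphism (Finset.univ \ J) hH hH'
      (fun t ht => hu t (by simpa using ht))
      (fun t ht => by rw [blocks h]; exact hΩt t (by simpa using ht))
    refine ⟨_, _, h.change hβ' hβ b2 b1, ?_⟩
    rw [toCols₂_mul]
    refine ((hβ'.mul_zero_level hH).sub .one).of_map_faceProj_eq_zero fun t ht => ?_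
    rw [map_faceProj_sub, map_faceProj_one, hβ'.map_faceProj_mul t hH,
      ← (b3 t (by simpa using ht)).1, ← hβ'.map_faceProj_mul t hβ, b2, map_faceProj_one, sub_self]
  have step : ∀ n : ℕ, ∃ (X : Matrix (μ ⊕ κ) κ (AddMonoidAlgebra R L))
      (Y : Matrix κ (μ ⊕ κ) (AddMonoidAlgebra R L)),
      IsGradedSplitting l ψ J 0 (fun _ => p) (fun _ => p) Ω X Y ∧
        IsGradedMatrix l ψ J 1 (fun _ => p) (fun _ => p) (Y.toCols₂ - 1) ∧
        IsGradedMatrix l ψ J n (fun _ => p) (fun _ => p) (upperPart rk (Y.toCols₂ - 1)) := by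
    intro n
    induction n with
    | zero =>
      obtain ⟨X, Y, h1, h2⟩ := base
      exact ⟨X, Y, h1, h2, (h2.upper rk).mono (by simp)⟩
    | succ n ih =>
      obtain ⟨X, Y, h1, h2, h3⟩ := ih
      obtain ⟨k, hk⟩ := exists_upperPart_pow_eq_zero rk (Y.toCols₂ - 1)
      have h4 := h2.upper rk
      have e : (1 - upperPart rk (Y.toCols₂ - 1)) * Y.toCols₂ - 1 =
          (Y.toCols₂ - 1) - upperPart rk (Y.toCols₂ - 1) -
            upperPart rk (Y.toCols₂ - 1) * (Y.toCols₂ - 1) := by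
        rw [Matrix.sub_mul, Matrix.one_mul, Matrix.mul_sub, Matrix.mul_one]
        abel
      refine ⟨_, _, h1.change (γ := 1 - upperPart rk (Y.toCols₂ - 1))
        (γ' := ∑ i ∈ Finset.range k, upperPart rk (Y.toCols₂ - 1) ^ i)
        (.sub .one (h4.mono zero_le_one))
        (.sum _ fun i _ => (h4.mono zero_le_one).pow_zero_level i)
        (by rw [mul_neg_geom_sum, hk, sub_zero]) (by rw [geom_sum_mul_neg, hk, sub_zero]), ?_, ?_⟩
      · rw [toCols₂_mul, e]
        exact (h2.sub h4).sub (h4.mul' (by simp) h2)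
      · rw [toCols₂_mul, e, upperPart_sub, upperPart_sub, upperPart_upperPart, sub_self]
        exact IsGradedMatrix.zero.sub ((h3.mul' (by simp) h2).upper rk)
  obtain ⟨X, Y, h1, h2, h3⟩ := step s
  refine ⟨X, Y, h1, ?_, ?_⟩
  · have hX : X.toRows₂ = 1 - (1 - Ω.toBlocks₂₂) - X.toRows₂ * (Y.toCols₂ - 1) := by
      rw [Matrix.mul_sub, Matrix.mul_one, blocks h1]
      abel
    have hX0 : IsGradedMatrix l ψ J 0 (fun _ => p) (fun _ => p) X.toRows₂ :=
      fun i k => h1.left (Sum.inr i) k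
    have key : ∀ t : ℕ, t ≤ s →
        IsGradedMatrix l ψ J t (fun _ => p) (fun _ => p) (upperPart rk X.toRows₂) := by
      intro t
      induction t with
      | zero => intro _; exact_mod_cast hX0.upper rk
      | succ t ih =>
        intro ht
        have ht' : ((t + 1 : ℕ) : ℤ) ≤ s := by exact_mod_cast ht
        rw [hX, upperPart_sub, upperPart_sub, upperPart_one]
        exact (IsGradedMatrix.zero.sub ((hΩ.mono ht').upper rk)).sub
          (hX0.upper_mul (ih (by lia)) h2 h3 ht' (by simp))
    exact key s le_rfl
  · rw [upperPart_sub, upperPart_one, sub_zero] at h3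
    exact h3

end Triangular

section Bordering

variable {R L P : Type*} [CommRing R] [AddCommGroup L] [AddCommGroup P] {q : ℕ}

/-- Idempotent graded matrices over a face all of whose rows have the same degree split. -/
def SplitsAtLevelZero (R : Type*) [CommRing R] {L P : Type*} [AddCommGroup L] [AddCommGroup P]
    {q : ℕ} (l : Fin q → L →+ ℤ) (ψ : L →+ P) (J : Finset (Fin q)) : Prop :=
  ∀ (p : P) {ι : Type} [Fintype ι] [DecidableEq ι] (Ω : Matrix ι ι (AddMonoidAlgebra R L)),
    IsGradedMatrix l ψ J 0 (fun _ => p) (fun _ => p) Ω → Ω * Ω = Ω →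
    ∃ (n : ℕ) (X : Matrix ι (Fin n) (AddMonoidAlgebra R L))
      (Y : Matrix (Fin n) ι (AddMonoidAlgebra R L)),
      IsGradedSplitting l ψ J 0 (fun _ => p) (fun _ => p) Ω X Y

variable {l : Fin q → L →+ ℤ} {ψ : L →+ P} {J : Finset (Fin q)}

lemma IsGradedMatrix.smul {ι κ : Type*} {d : ι → P} {δ : κ → P} {c c' e : ℤ}
    {x : AddMonoidAlgebra R L} {X : Matrix ι κ (AddMonoidAlgebra R L)}
    (hX : IsGradedMatrix l ψ J c d δ X) (hx : x ∈ supportedOn R (levelSet l ψ J c' 0))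
    (he : e ≤ c' + c) : IsGradedMatrix l ψ J e d δ (x • X) := fun i k =>
  mul_mem_levelSet he (zero_add _) hx (hX i k)

lemma IsGradedSplitting.reindex {ι κ τ : Type*} [Fintype ι] [Fintype κ] [DecidableEq κ]
    [Fintype τ] [DecidableEq τ] {d : ι → P} {δ : κ → P} {c : ℤ}
    {E : Matrix ι ι (AddMonoidAlgebra R L)} {X : Matrix ι κ (AddMonoidAlgebra R L)}
    {Y : Matrix κ ι (AddMonoidAlgebra R L)} (h : IsGradedSplitting l ψ J c d δ E X Y) (e : τ ≃ κ) :
    IsGradedSplitting l ψ J c d (δ ∘ e) E (X.submatrix id e) (Y.submatrix e id) where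
  left := fun i k => h.left i (e k)
  right := fun k i => h.right (e k) i
  mul_eq := by
    rw [← h.mul_eq]
    exact Matrix.submatrix_mul_equiv X Y id e id
  mul_eq_one := by
    rw [← Matrix.submatrix_mul _ _ _ id _ Function.bijective_id, h.mul_eq_one,
      Matrix.submatrix_one_equiv]

/-- Two graded matrices that are almost inverse to each other can be corrected by an invertible
matrix so that they get level zero. -/
lemma exists_level_correction [Nontrivial R] {μ κ : Type} [Fintype μ] [DecidableEq μ] [Fintype κ]
    [DecidableEq κ] {p : P} (h0 : SplitsAtLevelZero R l ψ J) {j : Fin q} (hj : j ∉ J)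
    {m : L} (hmJ : ∀ c ∈ J, l c m = 0) (hm : ∀ c ∉ J, 1 ≤ l c m) (hψ : ψ m = 0)
    {B : ℕ} (hB : ∀ c, l c m ≤ B) {G : Matrix μ κ (AddMonoidAlgebra R L)}
    {G' : Matrix κ μ (AddMonoidAlgebra R L)} {b s N : ℕ} (hs : 1 ≤ s) (hsN : s ≤ N)
    (hN1 : b + b * B ≤ N) (hN2 : 2 * b + 1 ≤ N)
    (hG : IsGradedMatrix l ψ J (-b) (fun _ => p) (fun _ => p) G)
    (hG' : IsGradedMatrix l ψ J (-b) (fun _ => p) (fun _ => p) G')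
    (hZ : IsGradedMatrix l ψ J N (fun _ => p) (fun _ => p) (1 - G' * G))
    (hW : IsGradedMatrix l ψ J N (fun _ => p) (fun _ => p) (1 - G * G')) (rk : κ → ℕ) :
    ∃ (w : Matrix μ κ (AddMonoidAlgebra R L)) (w' : Matrix κ μ (AddMonoidAlgebra R L)),
      IsGradedSplitting l ψ J (-b) (fun _ => p) (fun _ => p) 1 w w' ∧
        IsGradedMatrix l ψ J 0 (fun _ => p) (fun _ => p) (w' * G) ∧
        IsGradedMatrix l ψ J 0 (fun _ => p) (fun _ => p) (G' * w) ∧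
        IsGradedMatrix l ψ J s (fun _ => p) (fun _ => p) (upperPart rk (w' * G)) ∧
        IsGradedMatrix l ψ J s (fun _ => p) (fun _ => p) (upperPart rk (G' * w)) := by
  zify at hN1 hN2
  have hbB : (0 : ℤ) ≤ b * B := by positivity
  obtain ⟨e, e', hee, he, he'⟩ : ∃ e e' : AddMonoidAlgebra R L, e * e' = 1 ∧
      e ∈ supportedOn R (levelSet l ψ J b 0) ∧
      e' ∈ supportedOn R (levelSet l ψ J (-(b * B)) 0) := by
    refine ⟨.single (b • m) 1, .single (-(b • m)) 1, ?_, ?_, ?_⟩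
    · simp [AddMonoidAlgebra.single_mul_single, AddMonoidAlgebra.one_def]
    · refine single_mem_supportedOn (X := levelSet l ψ J b 0) ?_ _
      refine ⟨fun c hc => by simp [hmJ c hc], fun c hc => ?_, by simp [hψ]⟩
      rw [map_nsmul, nsmul_eq_mul]
      exact le_mul_of_one_le_right (by positivity) (hm c hc)
    · refine single_mem_supportedOn (X := levelSet l ψ J (-(b * B)) 0) ?_ _
      refine ⟨fun c hc => by simp [hmJ c hc], fun c hc => ?_, by simp [hψ]⟩
      rw [map_neg, map_nsmul, nsmul_eq_mul]
      exact neg_le_neg (mul_le_mul_of_nonneg_left (hB c) (by positivity))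
  let Q : Matrix μ (μ ⊕ κ) (AddMonoidAlgebra R L) :=
    Matrix.fromCols (e • (1 : Matrix μ μ (AddMonoidAlgebra R L))) G
  let T : Matrix (μ ⊕ κ) μ (AddMonoidAlgebra R L) := Matrix.fromRows (e' • (1 - G * G')) G'
  have hQT : Q * T = 1 := by
    rw [Matrix.fromCols_mul_fromRows, Matrix.smul_mul, Matrix.mul_smul, smul_smul, hee, one_smul,
      Matrix.one_mul, sub_add_cancel]
  have hQ : IsGradedMatrix l ψ J (-b) (fun _ => p) (fun _ => p) Q := by
    rintro i (k | k)
    · exact (IsGradedMatrix.one (d := fun _ => p)).smul he (by lia) i k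
    · exact hG i k
  have hT : IsGradedMatrix l ψ J (-b) (fun _ => p) (fun _ => p) T := by
    rintro (i | i) k
    · exact hW.smul he' (by lia) i k
    · exact hG' i k
  have hTQ : T * Q = Matrix.fromBlocks
      (e' • (1 - G * G') * (e • (1 : Matrix μ μ (AddMonoidAlgebra R L))))
      (e' • (1 - G * G') * G)
      (G' * (e • (1 : Matrix μ μ (AddMonoidAlgebra R L)))) (G' * G) :=
    Matrix.fromRows_mul_fromCols _ _ _ _
  have hΩ : IsGradedMatrix l ψ J 0 (fun _ => p) (fun _ => p) (T * Q) := by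
    rw [hTQ]
    have h1 : IsGradedMatrix l ψ J b (fun _ => p) (fun _ => p)
        (e • (1 : Matrix μ μ (AddMonoidAlgebra R L))) :=
      (IsGradedMatrix.one (d := fun _ => p)).smul he (by simp)
    have h2 : IsGradedMatrix l ψ J b (fun _ => p) (fun _ => p) (e' • (1 - G * G')) :=
      hW.smul he' (by lia)
    have h3 : IsGradedMatrix l ψ J 0 (fun _ => p) (fun _ => p) (G' * G) := by
      rw [← sub_sub_cancel 1 (G' * G)]
      exact IsGradedMatrix.one.sub (hZ.mono (by simp))
    rintro (i | i) (k | k)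
    · exact h2.mul' (by lia) h1 i k
    · exact h2.mul' (by lia) hG i k
    · exact hG'.mul' (by lia) h1 i k
    · exact h3 i k
  have hidem : T * Q * (T * Q) = T * Q := by
    rw [Matrix.mul_assoc, ← Matrix.mul_assoc Q, hQT, Matrix.one_mul]
  have facts : ∀ {τ : Type} [Fintype τ] [DecidableEq τ]
      {X : Matrix (μ ⊕ κ) τ (AddMonoidAlgebra R L)} {Y : Matrix τ (μ ⊕ κ) (AddMonoidAlgebra R L)},
      IsGradedSplitting l ψ J 0 (fun _ => p) (fun _ => p) (T * Q) X Y →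
      IsGradedSplitting l ψ J (-b) (fun _ => p) (fun _ => p) 1 (Q * X) (Y * T) ∧
        Y * T * G = Y.toCols₂ ∧ G' * (Q * X) = X.toRows₂ := by
    intro τ _ _ X Y h
    have hY : Y * (T * Q) = Y := by
      rw [← h.mul_eq, ← Matrix.mul_assoc, h.mul_eq_one, Matrix.one_mul]
    have hX : T * Q * X = X := by
      rw [← h.mul_eq, Matrix.mul_assoc, h.mul_eq_one, Matrix.mul_one]
    refine ⟨⟨hQ.mul' (by simp) h.left, h.right.mul' (by simp) hT, ?_, ?_⟩, ?_, ?_⟩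
    · calc _ = Q * (X * Y) * T := by simp only [Matrix.mul_assoc]
        _ = Q * T * (Q * T) := by rw [h.mul_eq]; simp only [Matrix.mul_assoc]
        _ = 1 := by rw [hQT, Matrix.one_mul]
    · rw [Matrix.mul_assoc, ← Matrix.mul_assoc T, hX, h.mul_eq_one]
    · conv_rhs => rw [← hY]
      rw [Matrix.mul_assoc]
      rfl
    · conv_rhs => rw [← hX]
      rw [Matrix.mul_assoc]
      rfl
  have hu : ∀ {τ : Type} [Fintype τ] [DecidableEq τ]
      {X : Matrix (μ ⊕ κ) τ (AddMonoidAlgebra R L)} {Y : Matrix τ (μ ⊕ κ) (AddMonoidAlgebra R L)},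
      IsGradedSplitting l ψ J 0 (fun _ => p) (fun _ => p) (T * Q) X Y →
      ∀ t ∉ J, (Y.toCols₂ * X.toRows₂).map (faceProj R (l t)) = 1 := by
    intro τ _ _ X Y h t ht
    obtain ⟨h1, h2, h3⟩ := facts h
    have : Y.toCols₂ * X.toRows₂ = 1 - Y * T * (1 - G * G') * (Q * X) := by
      rw [← h2, ← h3, Matrix.mul_sub, Matrix.sub_mul, Matrix.mul_one, h1.mul_eq_one,
        sub_sub_cancel]
      simp only [Matrix.mul_assoc]
    rw [this, map_faceProj_sub, map_faceProj_one,
      ((h1.right.mul hW).mul' (e := 1) (by lia) h1.left).map_faceProj_eq_zero ht, sub_zero]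
  obtain ⟨n, X, Y, h⟩ := h0 p _ hΩ hidem
  have hZ' : (X.toRows₂ * Y.toCols₂).map (faceProj R (l j)) = 1 := by
    have : X.toRows₂ * Y.toCols₂ = (X * Y).toBlocks₂₂ := rfl
    rw [this, h.mul_eq, hTQ, Matrix.toBlocks_fromBlocks₂₂, ← sub_sub_cancel 1 (G' * G),
      map_faceProj_sub, map_faceProj_one,
      (hZ.mono (by lia)).map_faceProj_eq_zero hj, sub_zero]
  have hH : IsGradedMatrix l ψ J 0 (fun _ => p) (fun _ => p) Y.toCols₂ :=
    fun i k => h.right i (Sum.inr k)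
  have hH' : IsGradedMatrix l ψ J 0 (fun _ => p) (fun _ => p) X.toRows₂ :=
    fun i k => h.left (Sum.inr i) k
  have h1 := hu h j hj
  rw [hH.map_faceProj_mul j hH'] at h1
  rw [hH'.map_faceProj_mul j hH] at hZ'
  have hcard := Matrix.square_of_invertible _ _ hZ' h1
  have σ : κ ≃ Fin n := Fintype.equivOfCardEq hcard
  obtain ⟨X, Y, h, hX, hY⟩ := exists_triangular_splitting (h.reindex σ) (hu (h.reindex σ)) hs
    (by
      rw [hTQ, Matrix.toBlocks_fromBlocks₂₂]
      exact hZ.mono (by lia)) rk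
  obtain ⟨h1, h2, h3⟩ := facts h
  refine ⟨_, _, h1, ?_, ?_, ?_, ?_⟩
  · rw [h2]
    exact fun i k => h.right i (Sum.inr k)
  · rw [h3]
    exact fun i k => h.left (Sum.inr i) k
  · rwa [h2]
  · rwa [h3]

end Bordering

section Coset

variable {R L P : Type*} [CommRing R] [AddCommGroup L] [AddCommGroup P] {q : ℕ}

/-- Idempotent graded matrices all of whose rows have the same degree split, if arbitrary negative
levels are allowed. -/
def SplitsAtSomeLevel (R : Type*) [CommRing R] {L P : Type*} [AddCommGroup L] [AddCommGroup P]
    {q : ℕ} (l : Fin q → L →+ ℤ) (ψ : L →+ P) (J : Finset (Fin q)) : Prop :=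
  ∀ (p : P) (a : ℕ) {ι : Type} [Fintype ι] [DecidableEq ι] (Ω : Matrix ι ι (AddMonoidAlgebra R L)),
    IsGradedMatrix l ψ J (-a) (fun _ => p) (fun _ => p) Ω → Ω * Ω = Ω →
    ∃ (b n : ℕ) (X : Matrix ι (Fin n) (AddMonoidAlgebra R L))
      (Y : Matrix (Fin n) ι (AddMonoidAlgebra R L)),
      IsGradedSplitting l ψ J (-b) (fun _ => p) (fun _ => p) Ω X Y

variable {l : Fin q → L →+ ℤ} {ψ : L →+ P} {J : Finset (Fin q)}

lemma IsGradedSplitting.mono {ι κ : Type*} [Fintype ι] [Fintype κ] [DecidableEq κ] {d : ι → P}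
    {δ : κ → P} {c c' : ℤ} {E : Matrix ι ι (AddMonoidAlgebra R L)}
    {X : Matrix ι κ (AddMonoidAlgebra R L)} {Y : Matrix κ ι (AddMonoidAlgebra R L)}
    (h : IsGradedSplitting l ψ J c d δ E X Y) (hc : c' ≤ c) :
    IsGradedSplitting l ψ J c' d δ E X Y :=
  ⟨h.left.mono hc, h.right.mono hc, h.mul_eq, h.mul_eq_one⟩

lemma IsGradedMatrix.conj_of_upper {κ : Type*} [Fintype κ] [DecidableEq κ] {δ : κ → P} {p : P}
    {H : Matrix κ κ (AddMonoidAlgebra R L)} {rk : κ → ℕ} {a : ℕ} {s : ℤ}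
    (hH : IsGradedMatrix l ψ J 0 (fun _ => p) (fun _ => p) H)
    (hHs : IsGradedMatrix l ψ J s (fun _ => p) (fun _ => p) (upperPart rk H)) {ν : κ → L}
    (ha : ∀ i c, |l c (ν i)| ≤ a) (hν : ∀ i, ∀ c ∈ J, l c (ν i) = 0)
    (hδ : ∀ i, δ i = p + ψ (ν i)) (hs : 2 * a ≤ s)
    (hmono : ∀ i j, rk j ≤ rk i → ∀ c ∉ J, l c (ν j) ≤ l c (ν i)) :
    IsGradedMatrix l ψ J 0 δ δ ((Matrix.diagonal fun i => AddMonoidAlgebra.single (ν i) (1 : R)) *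
      H * Matrix.diagonal fun i => AddMonoidAlgebra.single (-ν i) (1 : R)) := fun i j => by
  rw [Matrix.mul_diagonal, Matrix.diagonal_mul]
  by_cases h : rk i < rk j
  · have h1 : AddMonoidAlgebra.single (ν i) (1 : R) ∈
        supportedOn R (levelSet l ψ J (-a) (ψ (ν i))) :=
      single_mem_supportedOn (X := levelSet l ψ J (-a) (ψ (ν i)))
        ⟨hν i, fun c _ => (abs_le.1 (ha i c)).1, rfl⟩ _
    have h2 : AddMonoidAlgebra.single (-ν j) (1 : R) ∈
        supportedOn R (levelSet l ψ J (-a) (-ψ (ν j))) := by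
      refine single_mem_supportedOn (X := levelSet l ψ J (-a) (-ψ (ν j))) ?_ _
      refine ⟨fun c hc => by simp [hν j c hc], fun c _ => ?_, map_neg _ _⟩
      rw [map_neg]
      exact neg_le_neg (abs_le.1 (ha j c)).2
    have h3 := hHs i j
    rw [upperPart_apply, if_pos h] at h3
    refine mul_mem_levelSet (by lia) ?_ (mul_mem_levelSet le_rfl rfl h1 h3) h2
    rw [hδ, hδ]
    abel
  · rw [mul_comm (AddMonoidAlgebra.single (ν i) (1 : R)), mul_assoc,
      AddMonoidAlgebra.single_mul_single, mul_one]
    have h1 : AddMonoidAlgebra.single (ν i + -ν j) (1 : R) ∈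
        supportedOn R (levelSet l ψ J 0 (ψ (ν i) - ψ (ν j))) := by
      refine single_mem_supportedOn (X := levelSet l ψ J 0 (ψ (ν i) - ψ (ν j))) ?_ _
      refine ⟨fun c hc => by simp [hν i c hc, hν j c hc], fun c hc => ?_, ?_⟩
      · rw [map_add, map_neg]
        have := hmono i j (not_lt.1 h) c hc
        lia
      · rw [map_add, map_neg, sub_eq_add_neg]
    refine mul_mem_levelSet (by simp) ?_ (hH i j) h1
    rw [hδ, hδ]
    abel

lemma exists_bounded_splitting {ι : Type} [Fintype ι] [DecidableEq ι] {d : ι → P} {p : P}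
    (h : SplitsAtSomeLevel R l ψ J) {E : Matrix ι ι (AddMonoidAlgebra R L)}
    (hE : IsGradedMatrix l ψ J 0 d d E) (hEE : E * E = E)
    {n : ι → L} (hn : ∀ i, ∀ c ∈ J, l c (n i) = 0) (hd : ∀ i, d i = p + ψ (n i)) :
    ∃ (b r : ℕ) (X : Matrix ι (Fin r) (AddMonoidAlgebra R L))
      (Y : Matrix (Fin r) ι (AddMonoidAlgebra R L)),
      IsGradedSplitting l ψ J (-b) d (fun _ => p) E X Y := by
  obtain ⟨a, ha⟩ := exists_abs_le l n
  have hD : IsGradedMatrix l ψ J (-a) d (fun _ => p) _ :=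
    IsGradedMatrix.diagonal_single (R := R) ha hn hd
  have hD' : IsGradedMatrix l ψ J (-a) (fun _ => p) d _ :=
    IsGradedMatrix.diagonal_single_neg (R := R) ha hn hd
  have e1 := diagonal_single_mul_neg (R := R) n
  have e2 := diagonal_single_neg_mul (R := R) n
  set D := Matrix.diagonal fun i => AddMonoidAlgebra.single (n i) (1 : R)
  set D' := Matrix.diagonal fun i => AddMonoidAlgebra.single (-n i) (1 : R)
  obtain ⟨b, r, X, Y, hXY⟩ := h p (2 * a) (D' * E * D)
    ((hD'.mul hE).mul' (by push_cast; lia) hD) (by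
      calc D' * E * D * (D' * E * D) = D' * E * (D * D') * E * D := by
            simp only [Matrix.mul_assoc]
        _ = D' * E * D := by rw [e1, Matrix.mul_one, Matrix.mul_assoc D', hEE])
  refine ⟨a + b, r, D * X, Y * D', hD.mul' (by push_cast; lia) hXY.left,
    hXY.right.mul' (by push_cast; lia) hD', ?_, ?_⟩
  · calc D * X * (Y * D') = D * (X * Y) * D' := by simp only [Matrix.mul_assoc]
      _ = D * D' * E * (D * D') := by rw [hXY.mul_eq]; simp only [Matrix.mul_assoc]
      _ = E := by rw [e1, Matrix.one_mul, Matrix.mul_one]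
  · calc Y * D' * (D * X) = Y * (D' * D) * X := by simp only [Matrix.mul_assoc]
      _ = 1 := by rw [e2, Matrix.mul_one, hXY.mul_eq_one]

/-- The splitting of a graded idempotent extends from the facets to a face if all the degrees lie in
one coset. -/
lemma exists_splitting_of_coset {ι κ : Type} [Fintype ι] [DecidableEq ι] [Fintype κ]
    [DecidableEq κ] {d : ι → P} {δ : κ → P} {p : P} (h0 : SplitsAtLevelZero R l ψ J)
    (h1 : SplitsAtSomeLevel R l ψ J) {j : Fin q} (hj : j ∉ J)
    {E : Matrix ι ι (AddMonoidAlgebra R L)} (hE : IsGradedMatrix l ψ J 0 d d E) (hEE : E * E = E)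
    {n : ι → L} (hn : ∀ i, ∀ c ∈ J, l c (n i) = 0) (hd : ∀ i, d i = p + ψ (n i))
    {ν₀ : κ → L} (hν₀ : ∀ k, ∀ c ∈ J, l c (ν₀ k) = 0) (hδ₀ : ∀ k, δ k = p + ψ (ν₀ k))
    (hX : ∀ j ∉ J, ∃ (X : Matrix ι κ (AddMonoidAlgebra R L))
      (Y : Matrix κ ι (AddMonoidAlgebra R L)),
        IsGradedSplitting l ψ (insert j J) 0 d δ (E.map (faceProj R (l j))) X Y) :
    ∃ (X : Matrix ι κ (AddMonoidAlgebra R L)) (Y : Matrix κ ι (AddMonoidAlgebra R L)),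
      IsGradedSplitting l ψ J 0 d δ E X Y := by
  rcases subsingleton_or_nontrivial R with hR | hR
  · have : Subsingleton (AddMonoidAlgebra R L) := Module.subsingleton R _
    exact ⟨0, 0, .zero, .zero, Subsingleton.elim _ _, Subsingleton.elim _ _⟩
  obtain ⟨f, hf, hEf, happ⟩ := exists_glued_level hE hEE hX
  by_cases hm : ∃ m : L, (∀ c ∈ J, l c m = 0) ∧ (∀ c ∉ J, 1 ≤ l c m) ∧ ψ m = 0
  swap
  · obtain ⟨N₁, hN₁⟩ := exists_level_eq_zero (R := R) hm hn hd hn hd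
    obtain ⟨N₂, hN₂⟩ := exists_level_eq_zero (R := R) hm hν₀ hδ₀ hν₀ hδ₀
    obtain ⟨g, hg, hgE, hZ, hW⟩ := happ (max N₁ N₂)
    exact ⟨f, g, hf, hg, (sub_eq_zero.1 (hN₁ _ (le_max_left _ _) _ hW)).symm,
      (sub_eq_zero.1 (hN₂ _ (le_max_right _ _) _ hZ)).symm⟩
  obtain ⟨m, hmJ, hm, hψ⟩ := hm
  let rk : κ → ℕ := fun k => Fintype.equivFin κ k
  have hrk : Function.Injective rk := Fin.val_injective.comp (Fintype.equivFin κ).injective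
  obtain ⟨b₀, hb₀⟩ := exists_abs_le l ν₀
  obtain ⟨B, hB⟩ := exists_abs_le l fun _ : Unit => m
  let ν : κ → L := fun k => ν₀ k + (rk k * (2 * b₀)) • m
  have hν : ∀ k, ∀ c ∈ J, l c (ν k) = 0 := fun k c hc => by simp [ν, hν₀ k c hc, hmJ c hc]
  have hδ : ∀ k, δ k = p + ψ (ν k) := fun k => by simp [ν, hψ, hδ₀]
  have hmono : ∀ i j, rk j ≤ rk i → ∀ c ∉ J, l c (ν j) ≤ l c (ν i) := by
    intro i j hij c hc
    rcases hij.eq_or_lt with h | h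
    · rw [hrk h]
    · have h2 := abs_le.1 (hb₀ i c)
      have h3 := abs_le.1 (hb₀ j c)
      have h4 : ((rk j : ℤ) + 1) ≤ rk i := by exact_mod_cast h
      have h5 := hm c hc
      have h6 : (0 : ℤ) ≤ ((rk i : ℤ) - rk j - 1) * (2 * b₀) * l c m :=
        mul_nonneg (mul_nonneg (by lia) (by positivity)) (by lia)
      have h7 : (0 : ℤ) ≤ 2 * b₀ * (l c m - 1) := mul_nonneg (by positivity) (by lia)
      simp only [ν, map_add, map_nsmul, nsmul_eq_mul, Nat.cast_mul, Nat.cast_ofNat]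
      linarith
  obtain ⟨a₁, ha₁⟩ := exists_abs_le l ν
  obtain ⟨a₂, r, Xh, Yh, hXY⟩ := exists_bounded_splitting h1 hE hEE hn hd
  obtain ⟨a, rfl⟩ : ∃ a, a = max a₁ a₂ := ⟨_, rfl⟩
  set a := max a₁ a₂ with ha_def
  have ha : ∀ i c, |l c (ν i)| ≤ a := fun i c => (ha₁ i c).trans (by simp [ha_def])
  replace hXY : IsGradedSplitting l ψ J (-a) d (fun _ => p) E Xh Yh :=
    hXY.mono (by simp [ha_def])
  have hT : IsGradedMatrix l ψ J (-a) δ (fun _ => p) _ :=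
    IsGradedMatrix.diagonal_single (R := R) ha hν hδ
  have hT' : IsGradedMatrix l ψ J (-a) (fun _ => p) δ _ :=
    IsGradedMatrix.diagonal_single_neg (R := R) ha hν hδ
  have hconj : ∀ {H : Matrix κ κ (AddMonoidAlgebra R L)}, _ → _ → IsGradedMatrix l ψ J 0 δ δ _ :=
    fun {H} hH hHs => IsGradedMatrix.conj_of_upper (rk := rk) (s := (2 * a + 1 : ℕ)) (H := H)
      hH hHs ha hν hδ (by push_cast; lia) hmono
  have e1 := diagonal_single_mul_neg (R := R) ν
  have e2 := diagonal_single_neg_mul (R := R) ν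
  set T := Matrix.diagonal fun i => AddMonoidAlgebra.single (ν i) (1 : R)
  set T' := Matrix.diagonal fun i => AddMonoidAlgebra.single (-ν i) (1 : R)
  let M := 6 * a + 2 * a * B + 1
  obtain ⟨g, hg, hgE, hZ, hW⟩ := happ (M + 2 * a)
  have eYEX : Yh * E * Xh = 1 := by
    rw [← hXY.mul_eq, ← Matrix.mul_assoc, hXY.mul_eq_one, Matrix.one_mul, hXY.mul_eq_one]
  let G := Yh * f * T
  let G' := T' * g * Xh
  have hGG' : 1 - G * G' = Yh * (E - f * g) * Xh := by
    rw [Matrix.mul_sub, Matrix.sub_mul, eYEX]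
    calc 1 - G * G' = 1 - Yh * f * (T * T') * g * Xh := by simp only [G, G', Matrix.mul_assoc]
      _ = _ := by rw [e1, Matrix.mul_one]; simp only [Matrix.mul_assoc]
  have hG'G : 1 - G' * G = T' * (1 - g * f) * T := by
    rw [Matrix.mul_sub, Matrix.sub_mul, Matrix.mul_one, e2]
    calc 1 - G' * G = 1 - T' * (g * (Xh * Yh)) * f * T := by
          simp only [G, G', Matrix.mul_assoc]
      _ = _ := by rw [hXY.mul_eq, hgE]; simp only [Matrix.mul_assoc]
  obtain ⟨w, w', hw, hH, hH', hHs, hHs'⟩ := exists_level_correction (b := 2 * a) (s := 2 * a + 1)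
    (N := M) h0 hj hmJ hm hψ (fun c => (le_abs_self _).trans (hB () c)) (G := G) (G' := G')
    (by lia) (by lia) (by lia) (by lia)
    ((hXY.right.mul hf).mul' (by push_cast; lia) hT)
    ((hT'.mul hg).mul' (by push_cast; lia) hXY.left)
    (by rw [hG'G]; exact (hT'.mul hZ).mul' (by push_cast; lia) hT)
    (by rw [hGG']; exact (hXY.right.mul hW).mul' (by push_cast; lia) hXY.left) rk
  have hMW : IsGradedMatrix l ψ J M (fun _ => p) (fun _ => p) (1 - G * G') := by
    rw [hGG']; exact (hXY.right.mul hW).mul' (by push_cast; lia) hXY.left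
  have TT' : ∀ {τ : Type} (Z : Matrix κ τ (AddMonoidAlgebra R L)), T * (T' * Z) = Z := by
    intro τ Z
    rw [← Matrix.mul_assoc, e1, Matrix.one_mul]
  have XYE : ∀ {τ : Type} (Z : Matrix ι τ (AddMonoidAlgebra R L)), Xh * (Yh * Z) = E * Z := by
    intro τ Z
    rw [← Matrix.mul_assoc, hXY.mul_eq]
  have EfZ : ∀ {τ : Type} (Z : Matrix κ τ (AddMonoidAlgebra R L)), E * (f * Z) = f * Z := by
    intro τ Z
    rw [← Matrix.mul_assoc, hEf]
  refine ⟨Xh * w * T', T * w' * Yh, ?_, ?_, ?_, ?_⟩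
  · have : Xh * w * T' = f * (T * (G' * w) * T') + Xh * (1 - G * G') * w * T' := by
      simp only [G, G', Matrix.mul_sub, Matrix.sub_mul, Matrix.mul_one, Matrix.mul_assoc, TT', XYE,
        EfZ]
      abel
    rw [this]
    refine (hf.mul_zero_level (hconj hH' hHs')).add
      (((hXY.left.mul hMW).mul hw.left).mul' ?_ hT')
    push_cast [M]
    nlinarith
  · have : T * w' * Yh = T * (w' * G) * T' * g + T * w' * (1 - G * G') * Yh := by
      simp only [G, G', Matrix.mul_sub, Matrix.sub_mul, Matrix.mul_one, Matrix.mul_assoc, TT',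
        hXY.mul_eq, hgE]
      abel
    rw [this]
    refine ((hconj hH hHs).mul_zero_level hg).add
      (((hT.mul hw.right).mul hMW).mul' ?_ hXY.right)
    push_cast [M]
    nlinarith
  · calc Xh * w * T' * (T * w' * Yh) = Xh * (w * (T' * T) * w') * Yh := by
          simp only [Matrix.mul_assoc]
      _ = E := by rw [e2, Matrix.mul_one, hw.mul_eq, Matrix.mul_one, hXY.mul_eq]
  · calc T * w' * Yh * (Xh * w * T') = T * (w' * (Yh * Xh) * w) * T' := by
          simp only [Matrix.mul_assoc]
      _ = 1 := by rw [hXY.mul_eq_one, Matrix.mul_one, hw.mul_eq_one, Matrix.mul_one, e1]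

end Coset

section Colours

variable {R L P : Type*} [CommRing R] [AddCommGroup L] [AddCommGroup P] {q : ℕ}
  {l : Fin q → L →+ ℤ} {ψ : L →+ P} {J : Finset (Fin q)} {C : Type*} [DecidableEq C]
  {ι κ μ : Type*}

lemma submatrix_mul_of_colours [Fintype κ] {c₁ : ι → C} {c₂ : κ → C} {c₃ : μ → C}
    {S : Type*} [Semiring S] {X : Matrix ι κ S} (Y : Matrix κ μ S)
    (hX : ∀ i k, c₁ i ≠ c₂ k → X i k = 0) (x : C) :
    (X * Y).submatrix (Subtype.val : {i // c₁ i = x} → ι) (Subtype.val : {m // c₃ m = x} → μ) =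
      X.submatrix (Subtype.val : {i // c₁ i = x} → ι) (Subtype.val : {k // c₂ k = x} → κ) *
        Y.submatrix (Subtype.val : {k // c₂ k = x} → κ)
          (Subtype.val : {m // c₃ m = x} → μ) := by
  ext1 i m
  simp only [Matrix.submatrix_apply, Matrix.mul_apply]
  rw [← Fintype.sum_subset (s := Finset.univ.filter fun k => c₂ k = x)]
  · exact Finset.sum_subtype _ (by simp) fun k => X i k * Y k m
  · intro k hk
    by_contra h
    exact hk (by rw [hX i k fun h' => h (by simp [← h', i.2]), zero_mul])

/-- A splitting can be assembled from splittings of the diagonal blocks. -/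
lemma exists_splitting_of_blocks [Fintype ι] [Fintype κ] [DecidableEq κ] {c : ι → C} {c' : κ → C}
    {a : ℤ} {d : ι → P} {δ : κ → P} {E : Matrix ι ι (AddMonoidAlgebra R L)}
    (hE : ∀ i k, c i ≠ c k → E i k = 0)
    (h : ∀ x, ∃ (X : Matrix {i // c i = x} {k // c' k = x} (AddMonoidAlgebra R L))
      (Y : Matrix {k // c' k = x} {i // c i = x} (AddMonoidAlgebra R L)),
      IsGradedSplitting l ψ J a (fun i : {i // c i = x} => d i)
        (fun k : {k // c' k = x} => δ k)
        (E.submatrix Subtype.val Subtype.val) X Y) :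
    ∃ (X : Matrix ι κ (AddMonoidAlgebra R L)) (Y : Matrix κ ι (AddMonoidAlgebra R L)),
      IsGradedSplitting l ψ J a d δ E X Y := by
  choose X Y h using h
  let X' : Matrix ι κ (AddMonoidAlgebra R L) := fun i k =>
    if hk : c' k = c i then X (c i) ⟨i, rfl⟩ ⟨k, hk⟩ else 0
  let Y' : Matrix κ ι (AddMonoidAlgebra R L) := fun k i =>
    if hk : c' k = c i then Y (c i) ⟨k, hk⟩ ⟨i, rfl⟩ else 0
  have hX' : ∀ i k, c i ≠ c' k → X' i k = 0 := fun i k hik => dif_neg (Ne.symm hik)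
  have hY' : ∀ k i, c' k ≠ c i → Y' k i = 0 := fun i k hik => dif_neg hik
  have hXx : ∀ x, X'.submatrix Subtype.val Subtype.val = X x := by
    rintro x
    ext1 ⟨i, rfl⟩ ⟨k, hk⟩
    exact dif_pos hk
  have hYx : ∀ x, Y'.submatrix Subtype.val Subtype.val = Y x := by
    rintro x
    ext1 ⟨k, hk⟩ ⟨i, rfl⟩
    exact dif_pos hk
  refine ⟨X', Y', fun i k => ?_, fun k i => ?_, ?_, ?_⟩
  · by_cases hk : c i = c' k
    · simpa [X', hk.symm] using (h (c i)).left ⟨i, rfl⟩ ⟨k, hk.symm⟩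
    · rw [hX' i k hk]
      exact Submodule.zero_mem _
  · by_cases hk : c' k = c i
    · simpa [Y', hk] using (h (c i)).right ⟨k, hk⟩ ⟨i, rfl⟩
    · rw [hY' k i hk]
      exact Submodule.zero_mem _
  · ext1 i k
    by_cases hik : c i = c k
    · have := congrFun (congrFun ((submatrix_mul_of_colours (c₃ := c) Y' hX' (c k)).trans
        (by rw [hXx, hYx, (h (c k)).mul_eq])) ⟨i, hik⟩) ⟨k, rfl⟩
      exact this
    · rw [hE i k hik, Matrix.mul_apply]
      refine Finset.sum_eq_zero fun m _ => ?_
      by_cases hm : c i = c' m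
      · rw [hY' m k (fun h => hik (hm.trans h)), mul_zero]
      · rw [hX' i m hm, zero_mul]
  · ext1 i k
    by_cases hik : c' i = c' k
    · have := congrFun (congrFun ((submatrix_mul_of_colours (c₃ := c') X' hY' (c' k)).trans
        (by rw [hXx, hYx, (h (c' k)).mul_eq_one])) ⟨i, hik⟩) ⟨k, rfl⟩
      refine this.trans ?_
      simp [Matrix.one_apply]
    · rw [Matrix.one_apply_ne (fun h => hik (congrArg c' h)), Matrix.mul_apply]
      refine Finset.sum_eq_zero fun m _ => ?_
      by_cases hm : c' i = c m
      · rw [hX' m k (fun h => hik (hm.trans h)), mul_zero]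
      · rw [hY' i m hm, zero_mul]

/-- A splitting by block matrices restricts to the blocks. -/
lemma IsGradedSplitting.submatrix [Fintype ι] [Fintype κ] [DecidableEq κ] {c : ι → C} {c' : κ → C}
    {a : ℤ} {d : ι → P} {δ : κ → P} {E : Matrix ι ι (AddMonoidAlgebra R L)}
    {X : Matrix ι κ (AddMonoidAlgebra R L)} {Y : Matrix κ ι (AddMonoidAlgebra R L)}
    (h : IsGradedSplitting l ψ J a d δ E X Y) (hX : ∀ i k, c i ≠ c' k → X i k = 0)
    (hY : ∀ k i, c' k ≠ c i → Y k i = 0) (x : C) :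
    IsGradedSplitting l ψ J a (fun i : {i // c i = x} => d i) (fun k : {k // c' k = x} => δ k)
      (E.submatrix Subtype.val Subtype.val) (X.submatrix Subtype.val Subtype.val)
      (Y.submatrix Subtype.val Subtype.val) where
  left := fun i k => h.left i k
  right := fun k i => h.right k i
  mul_eq := (submatrix_mul_of_colours Y hX x).symm.trans (by rw [h.mul_eq])
  mul_eq_one := (submatrix_mul_of_colours X hY x).symm.trans
    (by rw [h.mul_eq_one]; exact Matrix.submatrix_one _ Subtype.val_injective)

variable (l ψ J) in
/-- The class of a degree modulo the degrees of the lattice points that span a face. -/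
def faceClass (p : P) : P ⧸ (⨅ j ∈ J, (l j).ker).map ψ := QuotientAddGroup.mk p

lemma faceClass_eq_iff {p p' : P} :
    faceClass l ψ J p = faceClass l ψ J p' ↔ ∃ n, (∀ j ∈ J, l j n = 0) ∧ p' = p + ψ n := by
  rw [faceClass, faceClass, QuotientAddGroup.eq, AddSubgroup.mem_map]
  simp only [AddSubgroup.mem_iInf, AddMonoidHom.mem_ker, eq_neg_add_iff_add_eq, eq_comm (b := p')]

lemma IsGradedMatrix.eq_zero_of_faceClass_ne {J' : Finset (Fin q)} (hJ : J ⊆ J') {a : ℤ}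
    {d : ι → P} {δ : κ → P} {X : Matrix ι κ (AddMonoidAlgebra R L)}
    (hX : IsGradedMatrix l ψ J' a d δ X) (i : ι) (k : κ)
    (h : faceClass l ψ J (d i) ≠ faceClass l ψ J (δ k)) : X i k = 0 := by
  ext s
  by_contra hs
  obtain ⟨h1, -, h3⟩ := hX i k s hs
  exact h (faceClass_eq_iff.2 ⟨s, fun j hj => h1 j (hJ hj), by rw [h3]; abel⟩).symm

/-- The splitting of a graded idempotent extends from the facets to a face. -/
lemma exists_splitting_of_facets {ι κ : Type} [Fintype ι] [DecidableEq ι] [Fintype κ]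
    [DecidableEq κ] {d : ι → P} {δ : κ → P} (h0 : SplitsAtLevelZero R l ψ J)
    (h1 : SplitsAtSomeLevel R l ψ J) {j : Fin q} (hj : j ∉ J)
    {E : Matrix ι ι (AddMonoidAlgebra R L)} (hE : IsGradedMatrix l ψ J 0 d d E) (hEE : E * E = E)
    (hX : ∀ j ∉ J, ∃ (X : Matrix ι κ (AddMonoidAlgebra R L))
      (Y : Matrix κ ι (AddMonoidAlgebra R L)),
        IsGradedSplitting l ψ (insert j J) 0 d δ (E.map (faceProj R (l j))) X Y) :
    ∃ (X : Matrix ι κ (AddMonoidAlgebra R L)) (Y : Matrix κ ι (AddMonoidAlgebra R L)),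
      IsGradedSplitting l ψ J 0 d δ E X Y := by
  classical
  have hcE := hE.eq_zero_of_faceClass_ne subset_rfl
  refine exists_splitting_of_blocks (c := fun i => faceClass l ψ J (d i))
    (c' := fun k => faceClass l ψ J (δ k)) hcE fun x => ?_
  obtain ⟨p, rfl⟩ : ∃ p, faceClass l ψ J p = x := QuotientAddGroup.mk_surjective x
  choose n hn hd using fun i : {i // faceClass l ψ J (d i) = faceClass l ψ J p} =>
    faceClass_eq_iff.1 i.2.symm
  choose ν hν hδ using fun i : {i // faceClass l ψ J (δ i) = faceClass l ψ J p} =>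
    faceClass_eq_iff.1 i.2.symm
  refine exists_splitting_of_coset h0 h1 hj (fun i k => hE i k) ?_ hn hd hν hδ fun j hj => ?_
  · rw [← submatrix_mul_of_colours E hcE, hEE]
  · obtain ⟨X, Y, hXY⟩ := hX j hj
    exact ⟨_, _, hXY.submatrix
      (hXY.left.eq_zero_of_faceClass_ne (Finset.subset_insert j J))
      (hXY.right.eq_zero_of_faceClass_ne (Finset.subset_insert j J)) _⟩

end Colours

section Existence

variable {R L P : Type*} [CommRing R] [AddCommGroup L] [AddCommGroup P] {q : ℕ}
  {l : Fin q → L →+ ℤ} {ψ : L →+ P}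

lemma IsGradedMatrix.univ_level {ι κ : Type*} {d : ι → P} {δ : κ → P} {c : ℤ} (c' : ℤ)
    {X : Matrix ι κ (AddMonoidAlgebra R L)} (hX : IsGradedMatrix l ψ Finset.univ c d δ X) :
    IsGradedMatrix l ψ Finset.univ c' d δ X := fun i k =>
  supportedOn_mono (hX i k) fun _ hs => ⟨hs.1, by simp, hs.2.2⟩

lemma exists_splitting_over_univ {ι : Type} [Fintype ι] [DecidableEq ι] {d : ι → P}
    (h : SplitsAtSomeLevel R l ψ Finset.univ) {E : Matrix ι ι (AddMonoidAlgebra R L)}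
    (hE : IsGradedMatrix l ψ Finset.univ 0 d d E) (hEE : E * E = E) :
    ∃ (N : ℕ) (δ : Fin N → P) (X : Matrix ι (Fin N) (AddMonoidAlgebra R L))
      (Y : Matrix (Fin N) ι (AddMonoidAlgebra R L)),
      IsGradedSplitting l ψ Finset.univ 0 d δ E X Y := by
  classical
  have hcE := hE.eq_zero_of_faceClass_ne subset_rfl
  set c : ι → P ⧸ (⨅ j ∈ Finset.univ, (l j).ker).map ψ := fun i => faceClass l ψ Finset.univ (d i)
  have hblock : ∀ x, ∃ (p : P) (r : ℕ) (X : Matrix {i // c i = x} (Fin r) (AddMonoidAlgebra R L))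
      (Y : Matrix (Fin r) {i // c i = x} (AddMonoidAlgebra R L)),
      IsGradedSplitting l ψ Finset.univ 0 (fun i : {i // c i = x} => d i) (fun _ => p)
        (E.submatrix Subtype.val Subtype.val) X Y := by
    intro x
    obtain ⟨p, rfl⟩ : ∃ p, faceClass l ψ Finset.univ p = x := QuotientAddGroup.mk_surjective x
    choose n hn hd using fun i : {i // c i = faceClass l ψ Finset.univ p} =>
      faceClass_eq_iff.1 i.2.symm
    obtain ⟨b, r, X, Y, hXY⟩ := exists_bounded_splitting h
      (E := E.submatrix (Subtype.val : {i // c i = faceClass l ψ Finset.univ p} → ι) Subtype.val)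
      (fun i k => hE i k) (by rw [← submatrix_mul_of_colours E hcE, hEE]) hn hd
    exact ⟨p, r, X, Y, hXY.left.univ_level 0, hXY.right.univ_level 0, hXY.mul_eq, hXY.mul_eq_one⟩
  choose p r X Y hXY using hblock
  let κ := Σ x : Set.range c, Fin (r x)
  obtain ⟨X', Y', h'⟩ : ∃ (X : Matrix ι κ (AddMonoidAlgebra R L))
      (Y : Matrix κ ι (AddMonoidAlgebra R L)),
      IsGradedSplitting l ψ Finset.univ 0 d (fun k : κ => p k.1) E X Y := by
    refine exists_splitting_of_blocks (c := c) (c' := fun k : κ => k.1.1) hcE fun x => ?_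
    by_cases hx : x ∈ Set.range c
    · let e : {k : κ // k.1.1 = x} ≃ Fin (r x) :=
        { toFun := fun k => Fin.cast (congrArg r k.2) k.1.2
          invFun := fun a => ⟨⟨⟨x, hx⟩, a⟩, rfl⟩
          left_inv := by
            rintro ⟨⟨⟨_, _⟩, _⟩, rfl⟩
            rfl
          right_inv := fun _ => rfl }
      have hδ : (fun k : {k : κ // k.1.1 = x} => p k.1.1) = (fun _ => p x) ∘ e :=
        funext fun k => congrArg p k.2
      exact ⟨_, _, hδ ▸ (hXY x).reindex e⟩
    · have : IsEmpty {i // c i = x} := ⟨fun i => hx ⟨i, i.2⟩⟩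
      have : IsEmpty {k : κ // k.1.1 = x} := ⟨fun k => hx (k.2 ▸ k.1.1.2)⟩
      exact ⟨0, 0, .zero, .zero, Subsingleton.elim _ _, Subsingleton.elim _ _⟩
  exact ⟨_, _, _, _, h'.reindex (Fintype.equivFin κ).symm⟩

/-- A splitting of the restriction of a graded idempotent to the lineality space extends. -/
lemma exists_splitting_of_univ {ι κ : Type} [Fintype ι] [DecidableEq ι] [Fintype κ]
    [DecidableEq κ] {d : ι → P} {δ : κ → P} (h0 : ∀ J, SplitsAtLevelZero R l ψ J)
    (h1 : ∀ J, SplitsAtSomeLevel R l ψ J) {X₀ : Matrix ι κ (AddMonoidAlgebra R L)}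
    {Y₀ : Matrix κ ι (AddMonoidAlgebra R L)} {J : Finset (Fin q)}
    {E : Matrix ι ι (AddMonoidAlgebra R L)} (hE : IsGradedMatrix l ψ J 0 d d E) (hEE : E * E = E)
    (h : IsGradedSplitting l ψ Finset.univ 0 d δ (E.map (faceProj R (∑ j, l j))) X₀ Y₀) :
    ∃ (X : Matrix ι κ (AddMonoidAlgebra R L)) (Y : Matrix κ ι (AddMonoidAlgebra R L)),
      IsGradedSplitting l ψ J 0 d δ E X Y := by
  induction hn : Jᶜ.card generalizing J E with
  | zero =>
    obtain rfl : J = Finset.univ := by simpa using hn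
    rw [hE.map_faceProj_univ_eq_self] at h
    exact ⟨X₀, Y₀, h⟩
  | succ n ih =>
    obtain ⟨j, hj⟩ : Jᶜ.Nonempty := Finset.card_pos.1 (by lia)
    rw [Finset.mem_compl] at hj
    refine exists_splitting_of_facets (h0 J) (h1 J) hj hE hEE fun a ha => ?_
    refine ih hE.map_faceProj_insert (by rw [← IsGradedMatrix.map_faceProj_mul a hE hE, hEE]) ?_ ?_
    · rwa [map_faceProj_comm, hE.map_faceProj_univ.map_faceProj_eq_self (Finset.mem_univ a)]
    · rw [Finset.compl_insert, Finset.card_erase_of_mem (Finset.mem_compl.2 ha), hn]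
      rfl

/-- Graded idempotent matrices over the monoid algebra of a cone split. -/
lemma exists_splitting {ι : Type} [Fintype ι] [DecidableEq ι] {d : ι → P}
    (h0 : ∀ J, SplitsAtLevelZero R l ψ J) (h1 : ∀ J, SplitsAtSomeLevel R l ψ J)
    {J : Finset (Fin q)} {E : Matrix ι ι (AddMonoidAlgebra R L)}
    (hE : IsGradedMatrix l ψ J 0 d d E) (hEE : E * E = E) :
    ∃ (N : ℕ) (δ : Fin N → P) (X : Matrix ι (Fin N) (AddMonoidAlgebra R L))
      (Y : Matrix (Fin N) ι (AddMonoidAlgebra R L)), IsGradedSplitting l ψ J 0 d δ E X Y := by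
  obtain ⟨N, δ, X₀, Y₀, h⟩ := exists_splitting_over_univ (h1 _) hE.map_faceProj_univ
    (by rw [← IsGradedMatrix.map_faceProj_univ_mul hE hE, hEE])
  exact ⟨N, δ, exists_splitting_of_univ h0 h1 hE hEE h⟩

end Existence

section Hypotheses

variable {R L P : Type u} [CommRing R] [AddCommGroup L] [AddCommGroup P] {q : ℕ}
  {l : Fin q → L →+ ℤ} {ψ : L →+ P} {J : Finset (Fin q)}

lemma splitsAtLevelZero_of_extended (hR : AllProjectiveFree R) {T : AddSubmonoid L}
    (hT : AllFGProjectiveExtended R (AddMonoidAlgebra R T)) (h : (T : Set L) = levelSet l ψ J 0 0) :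
    SplitsAtLevelZero R l ψ J := by
  intro p ι _ _ Ω hΩ hidem
  have hrange : Set.range T.subtype = levelSet l ψ J 0 (p - p) := by
    rw [AddSubmonoid.coe_subtype, Subtype.range_coe, h, sub_self]
  obtain ⟨n, X, Y, hX, hY, h1, h2⟩ := exists_splitting_supportedOn hR hT T.subtype_injective hidem
    fun i k => supportedOn_mono (hΩ i k) hrange.ge
  exact ⟨n, X, Y, fun i k => hrange ▸ hX i k, fun i k => hrange ▸ hY i k, h1, h2⟩

lemma splitsAtSomeLevel_of_extended (hR : AllProjectiveFree R) {T : AddSubgroup L}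
    (hT : AllFGProjectiveExtended R (AddMonoidAlgebra R T))
    (h : (T : Set L) = {s | (∀ j ∈ J, l j s = 0) ∧ ψ s = 0}) : SplitsAtSomeLevel R l ψ J := by
  intro p a ι _ _ Ω hΩ hidem
  have hrange : Set.range T.subtype = {s | (∀ j ∈ J, l j s = 0) ∧ ψ s = p - p} := by
    rw [AddSubgroup.coe_subtype, Subtype.range_coe, h, sub_self]
  obtain ⟨n, X, Y, hX, hY, h1, h2⟩ := exists_splitting_supportedOn hR hT T.subtype_injective hidem
    fun i k => supportedOn_mono (hΩ i k) fun s hs => hrange.ge ⟨hs.1, hs.2.2⟩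
  obtain ⟨b, hb⟩ := exists_isGradedMatrix (l := l) (ψ := ψ) (J := J) (d := fun _ => p)
    (δ := fun _ => p) fun i k => hrange ▸ hX i k
  obtain ⟨b', hb'⟩ := exists_isGradedMatrix (l := l) (ψ := ψ) (J := J) (d := fun _ => p)
    (δ := fun _ => p) fun i k => hrange ▸ hY i k
  exact ⟨max b b', n, X, Y, hb.mono (by simp), hb'.mono (by simp), h1, h2⟩

lemma isTorsionFreeAddMonoid_addSubgroup [Module.Free ℤ L] (T : AddSubgroup L) :
    IsTorsionFreeAddMonoid T := fun n hn x y h => by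
  have : IsAddTorsionFree L := Module.isTorsionFree_int_iff_isAddTorsionFree.1 inferInstance
  refine Subtype.ext (nsmul_right_injective hn.ne' ?_)
  simpa using congrArg Subtype.val h

/-- Finitely many rational functionals on a finitely generated group have a common denominator. -/
lemma exists_integral_multiple {L : Type*} [AddCommGroup L] [AddGroup.FG L] {ι : Type*} [Finite ι]
    (l : ι → L →+ ℚ) : ∃ D : ℕ, 0 < D ∧ ∃ l' : ι → L →+ ℤ, ∀ j s, (l' j s : ℚ) = D * l j s := by
  have := Fintype.ofFinite ι
  obtain ⟨S, hS⟩ := AddGroup.fg_def.1 ‹AddGroup.FG L›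
  let D : ℕ := ∏ j, ∏ s ∈ S, (l j s).den
  have hD : 0 < D := Finset.prod_pos fun j _ => Finset.prod_pos fun s _ => (l j s).den_pos
  have key : ∀ j s, ∃ z : ℤ, (z : ℚ) = D * l j s := by
    intro j s
    have hs : s ∈ AddSubgroup.closure (S : Set L) := hS ▸ AddSubgroup.mem_top s
    induction hs using AddSubgroup.closure_induction with
    | mem s hs =>
      obtain ⟨c, hc⟩ : (l j s).den ∣ D :=
        (Finset.dvd_prod_of_mem _ hs).trans
          (Finset.dvd_prod_of_mem (fun j => ∏ s ∈ S, (l j s).den) (Finset.mem_univ j))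
      refine ⟨c * (l j s).num, ?_⟩
      rw [hc]
      push_cast
      linear_combination (-c : ℚ) * Rat.den_mul_eq_num (l j s)
    | zero => exact ⟨0, by simp⟩
    | add x y _ _ hx hy =>
      obtain ⟨a, ha⟩ := hx
      obtain ⟨b, hb⟩ := hy
      exact ⟨a + b, by rw [map_add, mul_add, ← ha, ← hb]; push_cast; rfl⟩
    | neg x _ hx =>
      obtain ⟨a, ha⟩ := hx
      exact ⟨-a, by rw [map_neg, mul_neg, ← ha]; push_cast; rfl⟩
  choose f hf using key
  refine ⟨D, hD, fun j => AddMonoidHom.mk' (f j) fun x y => ?_, hf⟩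
  have : ((f j (x + y) : ℤ) : ℚ) = (f j x + f j y : ℤ) := by
    push_cast
    rw [hf, hf, hf, map_add, mul_add]
  exact_mod_cast this

lemma coe_kerSubmonoidIn_face {L P : Type*} [AddCommGroup L] [AddCommGroup P] {q : ℕ}
    {l : Fin q → L →+ ℚ} {l' : Fin q → L →+ ℤ} {ψ : L →+ P} {J : Finset (Fin q)} {D : ℕ}
    (hD : 0 < D) (h : ∀ j s, (l' j s : ℚ) = D * l j s) :
    (kerSubmonoidIn (faceLatticePoints l (∑ j ∈ J, l j)) ψ : Set L) = levelSet l' ψ J 0 0 := by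
  have hD' : (0 : ℚ) < D := by exact_mod_cast hD
  have h0 : ∀ j s, l' j s = 0 ↔ l j s = 0 := fun j s => by
    rw [← Int.cast_eq_zero (α := ℚ), h]
    simp [hD.ne']
  have hle : ∀ j s, 0 ≤ l' j s ↔ 0 ≤ l j s := fun j s => by
    rw [← Int.cast_nonneg_iff (R := ℚ), h, mul_nonneg_iff_of_pos_left hD']
  ext s
  change ((∀ j, 0 ≤ l j s) ∧ (∑ j ∈ J, l j) s = 0) ∧ ψ s = 0 ↔
    (∀ j ∈ J, l' j s = 0) ∧ (∀ j ∉ J, 0 ≤ l' j s) ∧ ψ s = 0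
  simp only [h0, hle, AddMonoidHom.finsetSum_apply]
  constructor
  · rintro ⟨⟨h1, h2⟩, h3⟩
    exact ⟨(Finset.sum_eq_zero_iff_of_nonneg fun j _ => h1 j).1 h2, fun j _ => h1 j, h3⟩
  · rintro ⟨h1, h2, h3⟩
    refine ⟨⟨fun j => ?_, Finset.sum_eq_zero h1⟩, h3⟩
    by_cases hj : j ∈ J
    · exact (h1 j hj).ge
    · exact h2 j hj

end Hypotheses

section DegreeComponents

variable {R Λ P : Type*} [CommRing R] [AddCommMonoid Λ] [AddCommGroup P] {deg : Λ →+ P}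

lemma monAlgGrading_eq_supportedOn (p : P) :
    monAlgGrading R deg p = supportedOn R {s | deg s = p} := by
  refine le_antisymm (Submodule.span_le.2 ?_) fun x hx => ?_
  · rintro _ ⟨s, hs, rfl⟩
    exact single_mem_supportedOn (X := {s | deg s = p}) hs _
  · rw [sum_single_coeff x]
    refine Submodule.sum_mem _ fun s hs => ?_
    rw [← mul_one (x.coeff s), ← smul_eq_mul, ← AddMonoidAlgebra.smul_single]
    exact Submodule.smul_mem _ _
      (Submodule.subset_span ⟨s, hx s (Finsupp.mem_support_iff.1 hs), rfl⟩)

open Classical in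
/-- The component of degree `p` of an element of a graded monoid algebra. -/
noncomputable def degProj (R : Type*) [CommRing R] {Λ P : Type*} [AddCommMonoid Λ] [AddCommGroup P]
    (deg : Λ →+ P) (p : P) : AddMonoidAlgebra R Λ →ₗ[R] AddMonoidAlgebra R Λ where
  toFun x := .ofCoeff (x.coeff.filter fun s => deg s = p)
  map_add' x y := by ext s; simp [Finsupp.filter_apply]
  map_smul' c x := by ext s; simp [Finsupp.filter_apply]

open Classical in
lemma coeff_degProj (p : P) (x : AddMonoidAlgebra R Λ) (s : Λ) :
    (degProj R deg p x).coeff s = if deg s = p then x.coeff s else 0 := by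
  simp [degProj, Finsupp.filter_apply]

lemma degProj_mem (p : P) (x : AddMonoidAlgebra R Λ) :
    degProj R deg p x ∈ monAlgGrading R deg p := by
  rw [monAlgGrading_eq_supportedOn]
  intro s hs
  rw [coeff_degProj] at hs
  by_contra h
  exact hs (if_neg h)

lemma eq_zero_of_degProj_eq_zero {x : AddMonoidAlgebra R Λ} (h : ∀ p, degProj R deg p x = 0) :
    x = 0 := by
  ext s
  have := congrArg (fun y => AddMonoidAlgebra.coeff y s) (h (deg s))
  simpa [coeff_degProj] using this

open Classical in
lemma degProj_single (p : P) (s : Λ) (r : R) :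
    degProj R deg p (.single s r) = if deg s = p then .single s r else 0 := by
  ext t
  rw [coeff_degProj]
  by_cases h : s = t
  · subst h; split_ifs <;> simp
  · split_ifs <;> simp [h]

lemma degProj_mul {a b c : P} {x : AddMonoidAlgebra R Λ} (hx : x ∈ monAlgGrading R deg a)
    (h : a + b = c) (y : AddMonoidAlgebra R Λ) :
    degProj R deg c (x * y) = x * degProj R deg b y := by
  rw [monAlgGrading_eq_supportedOn] at hx
  rw [sum_single_coeff x, sum_single_coeff y]
  rw [map_sum, Finset.sum_mul_sum, Finset.sum_mul_sum, map_sum]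
  refine Finset.sum_congr rfl fun s hs => ?_
  rw [map_sum]
  refine Finset.sum_congr rfl fun t ht => ?_
  have h1 : deg s = a := hx s (Finsupp.mem_support_iff.1 hs)
  rw [AddMonoidAlgebra.single_mul_single, degProj_single, degProj_single]
  have h2 : deg (s + t) = c ↔ deg t = b := by rw [map_add, h1, ← h, add_right_inj]
  by_cases h3 : deg t = b
  · rw [if_pos h3, if_pos (h2.2 h3), AddMonoidAlgebra.single_mul_single]
  · rw [if_neg h3, if_neg (mt h2.1 h3), mul_zero]

end DegreeComponents

section GradedModules

variable {R Λ P M : Type*} [CommRing R] [AddCommMonoid Λ] [AddCommGroup P] [DecidableEq P]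
  {deg : Λ →+ P} [AddCommGroup M] [Module R M] [Module (AddMonoidAlgebra R Λ) M]
  [IsScalarTower R (AddMonoidAlgebra R Λ) M] {ℳ : P → Submodule R M}

/-- The degree components of a graded module. -/
lemma IsGradedModule.exists_component (hM : IsGradedModule (monAlgGrading R deg) ℳ) (c : P) :
    ∃ pr : M →ₗ[R] M, (∀ m ∈ ℳ c, pr m = m) ∧
      ∀ b, ∀ m ∈ ℳ b, ∀ x : AddMonoidAlgebra R Λ, pr (x • m) = degProj R deg (c - b) x • m := by
  let e := LinearEquiv.ofBijective (DirectSum.coeLinearMap ℳ) hM.is_internal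
  let pr : M →ₗ[R] M := (ℳ c).subtype ∘ₗ DirectSum.component R P (fun p => ℳ p) c ∘ₗ e.symm
  have hpr : ∀ b (m : ℳ b), pr m = if b = c then (m : M) else 0 := by
    intro b m
    have : e.symm m = DirectSum.lof R P (fun p => ℳ p) b m := by
      rw [LinearEquiv.symm_apply_eq]
      exact (DirectSum.coeLinearMap_lof ℳ b m).symm
    simp only [pr, LinearMap.comp_apply, LinearEquiv.coe_coe, this]
    split_ifs with h
    · subst h
      simp
    · rw [DirectSum.component.of, dif_neg h]
      rfl
  refine ⟨pr, fun m hm => (hpr c ⟨m, hm⟩).trans (if_pos rfl), fun b m hm x => ?_⟩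
  rw [sum_single_coeff x]
  simp only [map_sum, Finset.sum_smul]
  refine Finset.sum_congr rfl fun s _ => ?_
  have hs : AddMonoidAlgebra.single s (x.coeff s) • m ∈ ℳ (deg s + b) := by
    refine hM.smul_mem ?_ hm
    rw [monAlgGrading_eq_supportedOn]
    exact single_mem_supportedOn (X := {t | deg t = deg s}) rfl _
  rw [hpr _ ⟨_, hs⟩, degProj_single]
  simp only [eq_sub_iff_add_eq]
  split_ifs <;> simp

/-- The homogeneous part of a relation between homogeneous elements is a relation. -/
lemma IsGradedModule.sum_degProj_smul (hM : IsGradedModule (monAlgGrading R deg) ℳ) {ι : Type*}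
    [Fintype ι] {g : ι → M} {e : ι → P} (hg : ∀ i, g i ∈ ℳ (e i)) {c : P} {m : M} (hm : m ∈ ℳ c)
    {v : ι → AddMonoidAlgebra R Λ} (hv : ∑ i, v i • g i = m) :
    ∑ i, degProj R deg (c - e i) (v i) • g i = m := by
  obtain ⟨pr, h1, h2⟩ := hM.exists_component c
  rw [← h1 m hm, ← hv, map_sum]
  exact Finset.sum_congr rfl fun i _ => (h2 _ _ (hg i) _).symm

lemma IsGradedModule.exists_generators (hM : IsGradedModule (monAlgGrading R deg) ℳ)
    [Module.Finite (AddMonoidAlgebra R Λ) M] :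
    ∃ (N : ℕ) (g : Fin N → M) (e : Fin N → P), (∀ i, g i ∈ ℳ (e i)) ∧
      Submodule.span (AddMonoidAlgebra R Λ) (Set.range g) = ⊤ := by
  have htop : Submodule.span (AddMonoidAlgebra R Λ) (⋃ p, (ℳ p : Set M)) = ⊤ := by
    rw [eq_top_iff]
    intro m _
    have hm : m ∈ ⨆ p, ℳ p := hM.is_internal.submodule_iSup_eq_top ▸ Submodule.mem_top
    induction hm using Submodule.iSup_induction' with
    | mem p m hm => exact Submodule.subset_span (Set.mem_iUnion.2 ⟨p, hm⟩)
    | zero => exact Submodule.zero_mem _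
    | add x y _ _ hx hy => exact Submodule.add_mem _ (hx trivial) (hy trivial)
  obtain ⟨S, hS, hspan⟩ := (Submodule.fg_span_iff_fg_span_finset_subset _).1
    (htop.symm ▸ Module.Finite.fg_top :
      (Submodule.span (AddMonoidAlgebra R Λ) (⋃ p, (ℳ p : Set M))).FG)
  let f := S.equivFin.symm
  choose e he using fun i => Set.mem_iUnion.1 (hS (f i).2)
  refine ⟨S.card, fun i => f i, e, he, ?_⟩
  rw [← htop, hspan]
  congr 1
  exact (f.surjective.range_comp (Subtype.val : S → M)).trans Subtype.range_coe

/-- A finitely generated graded projective module is the image of a homogeneous idempotent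
matrix. -/
lemma IsGradedModule.exists_idempotent (hM : IsGradedModule (monAlgGrading R deg) ℳ)
    [Module.Finite (AddMonoidAlgebra R Λ) M] [Module.Projective (AddMonoidAlgebra R Λ) M] :
    ∃ (N : ℕ) (g : Fin N → M) (e : Fin N → P)
      (E : Matrix (Fin N) (Fin N) (AddMonoidAlgebra R Λ)), (∀ i, g i ∈ ℳ (e i)) ∧
      Submodule.span (AddMonoidAlgebra R Λ) (Set.range g) = ⊤ ∧
      (∀ i k, E i k ∈ monAlgGrading R deg (e k - e i)) ∧ E * E = E ∧
      (∀ k, ∑ i, E i k • g i = g k) ∧ ∀ v, ∑ i, v i • g i = 0 → E.mulVec v = 0 := by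
  obtain ⟨N, g, e, hg, hspan⟩ := hM.exists_generators
  let π := Fintype.linearCombination (AddMonoidAlgebra R Λ) g
  have hπ : ∀ v, π v = ∑ i, v i • g i := fun v => Fintype.linearCombination_apply _ _ _
  have hsurj : Function.Surjective π := by
    rw [← LinearMap.range_eq_top, Fintype.range_linearCombination, hspan]
  obtain ⟨s, hs⟩ := Module.projective_lifting_property π LinearMap.id hsurj
  let S : Matrix (Fin N) (Fin N) (AddMonoidAlgebra R Λ) := fun i k => s (g k) i
  let E : Matrix (Fin N) (Fin N) (AddMonoidAlgebra R Λ) :=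
    fun i k => degProj R deg (e k - e i) (S i k)
  have hS : ∀ v i, ∑ k, S i k * v k = s (π v) i := by
    intro v i
    simp only [hπ, map_sum, map_smul, Finset.sum_apply, Pi.smul_apply, smul_eq_mul, S]
    exact Finset.sum_congr rfl fun k _ => mul_comm _ _
  have hEg : ∀ k, ∑ i, E i k • g i = g k := fun k =>
    hM.sum_degProj_smul hg (hg k) ((hπ _).symm.trans (LinearMap.congr_fun hs (g k)))
  have hker : ∀ v, ∑ i, v i • g i = 0 → E.mulVec v = 0 := by
    intro v hv
    ext1 i
    refine eq_zero_of_degProj_eq_zero (deg := deg) fun p => ?_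
    let w : Fin N → AddMonoidAlgebra R Λ := fun k => degProj R deg (p + e i - e k) (v k)
    have hw : π w = 0 := (hπ w).trans (hM.sum_degProj_smul hg (Submodule.zero_mem _) hv)
    have h1 : ∑ k, S i k * w k = 0 := by rw [hS, hw, map_zero, Pi.zero_apply]
    rw [Matrix.mulVec, dotProduct, map_sum, ← map_zero (degProj R deg p), ← h1, map_sum]
    refine Finset.sum_congr rfl fun k _ => ?_
    rw [degProj_mul (degProj_mem _ _) (by abel : e k - e i + (p + e i - e k) = p), mul_comm (S i k),
      degProj_mul (degProj_mem _ _) (by abel : p + e i - e k + (e k - e i) = p), mul_comm]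
  refine ⟨N, g, e, E, hg, hspan, fun i k => degProj_mem _ _, ?_, hEg, hker⟩
  ext1 i k
  have := congrFun (hker ((fun i => E i k) - Pi.single k 1) ?_) i
  · rw [Matrix.mulVec_sub, Matrix.mulVec_single_one] at this
    exact sub_eq_zero.1 this
  · simp only [Pi.sub_apply, sub_smul, Finset.sum_sub_distrib, hEg, sub_eq_zero]
    rw [Finset.sum_eq_single k (fun j _ hj => by rw [Pi.single_eq_of_ne hj, zero_smul]) (by simp)]
    simp

/-- A homogeneous splitting of the idempotent matrix of a graded module yields a homogeneous
basis. -/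
lemma IsGradedModule.exists_basis (hM : IsGradedModule (monAlgGrading R deg) ℳ) {ι κ : Type*}
    [Fintype ι] [Fintype κ] [DecidableEq κ] {g : ι → M} {e : ι → P} {δ : κ → P}
    {E : Matrix ι ι (AddMonoidAlgebra R Λ)} (hg : ∀ i, g i ∈ ℳ (e i))
    (hspan : Submodule.span (AddMonoidAlgebra R Λ) (Set.range g) = ⊤)
    (hEg : ∀ k, ∑ i, E i k • g i = g k) (hker : ∀ v, ∑ i, v i • g i = 0 → E.mulVec v = 0)
    {X : Matrix ι κ (AddMonoidAlgebra R Λ)} {Y : Matrix κ ι (AddMonoidAlgebra R Λ)}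
    (hX : ∀ i k, X i k ∈ monAlgGrading R deg (δ k - e i)) (h1 : X * Y = E) (h2 : Y * X = 1) :
    ∃ b : Module.Basis κ (AddMonoidAlgebra R Λ) M, ∀ k, b k ∈ ℳ (δ k) := by
  let b : κ → M := fun k => ∑ i, X i k • g i
  have hb : ∀ v : κ → AddMonoidAlgebra R Λ, ∑ k, v k • b k = ∑ i, X.mulVec v i • g i := by
    intro v
    simp only [b, Finset.smul_sum, Matrix.mulVec, dotProduct, Finset.sum_smul, smul_smul]
    rw [Finset.sum_comm]
    simp only [mul_comm]
  have hli : LinearIndependent (AddMonoidAlgebra R Λ) b := by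
    rw [Fintype.linearIndependent_iff]
    intro v hv
    have h3 := hker _ ((hb v).symm.trans hv)
    have h4 : v = 0 := by
      calc v = Y.mulVec (E.mulVec (X.mulVec v)) := by
            rw [← h1]
            simp only [Matrix.mulVec_mulVec, Matrix.mul_assoc, h2]
            rw [Matrix.mul_one, h2, Matrix.one_mulVec]
        _ = 0 := by rw [h3, Matrix.mulVec_zero]
    exact fun k => congrFun h4 k
  have hsp : ⊤ ≤ Submodule.span (AddMonoidAlgebra R Λ) (Set.range b) := by
    rw [← hspan, Submodule.span_le]
    rintro _ ⟨i, rfl⟩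
    have : g i = ∑ k, Y k i • b k := by
      rw [hb fun k => Y k i, ← hEg i, ← h1]
      rfl
    rw [this]
    exact Submodule.sum_mem _ fun k _ =>
      Submodule.smul_mem _ _ (Submodule.subset_span (Set.mem_range_self k))
  refine ⟨Module.Basis.mk hli hsp, fun k => ?_⟩
  rw [Module.Basis.mk_apply]
  refine Submodule.sum_mem _ fun i _ => ?_
  simpa using hM.smul_mem (hX i k) (hg i)

end GradedModules

section TrivialModules

/-- The coordinate vectors of a free module, placed in prescribed degrees, define a grading. -/
lemma isInternal_coordinates {R P ι : Type*} [CommRing R] [DecidableEq P] [Fintype ι]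
    [DecidableEq ι] (δ : ι → P) (ℱ : P → Submodule R (ι → R))
    (hℱ : ∀ p f, f ∈ ℱ p ↔ ∀ k, δ k ≠ p → f k = 0) : DirectSum.IsInternal ℱ := by
  have hcoord : ∀ (x : DirectSum P fun p => ℱ p) (k : ι),
      DirectSum.coeLinearMap ℱ x k = (x (δ k) : ι → R) k := by
    intro x k
    induction x using DirectSum.induction_on with
    | zero => simp
    | add x y hx hy => simp [hx, hy]
    | of p f =>
      rw [DirectSum.coeLinearMap_of]
      by_cases h : δ k = p
      · subst h
        rw [DirectSum.of_eq_same]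
      · rw [DirectSum.of_eq_of_ne _ _ _ h, (hℱ p f).1 f.2 k h]
        rfl
  refine ⟨fun x y hxy => ?_, fun f => ?_⟩
  · refine DFinsupp.ext fun p => Subtype.ext (funext fun k => ?_)
    by_cases h : δ k = p
    · subst h
      rw [← hcoord, ← hcoord]
      exact congrFun hxy k
    · rw [(hℱ p _).1 (x p).2 k h, (hℱ p _).1 (y p).2 k h]
  · refine ⟨∑ k, DirectSum.of (fun p => ℱ p) (δ k) ⟨Pi.single k (f k), (hℱ _ _).2 fun i hi => ?_⟩,
      ?_⟩
    · exact Pi.single_eq_of_ne (fun h => hi (congrArg δ h)) _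
    · rw [map_sum]
      simp only [DirectSum.coeAddMonoidHom_of]
      exact Finset.univ_sum_single f

/-- A graded module with a homogeneous basis is trivial. -/
lemma IsGradedModule.isGradedExtendedFrom {R Λ P M : Type u} [CommRing R] [AddCommMonoid Λ]
    [AddCommGroup P] [DecidableEq P] {deg : Λ →+ P} [AddCommGroup M] [Module R M]
    [Module (AddMonoidAlgebra R Λ) M] [IsScalarTower R (AddMonoidAlgebra R Λ) M]
    {ℳ : P → Submodule R M} (hM : IsGradedModule (monAlgGrading R deg) ℳ) {κ : Type} [Fintype κ]
    (b : Module.Basis κ (AddMonoidAlgebra R Λ) M) {δ : κ → P} (hb : ∀ k, b k ∈ ℳ (δ k)) :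
    IsGradedExtendedFrom R (monAlgGrading R deg) M ℳ := by
  classical
  let ℱ : P → Submodule R (κ → R) := fun p =>
    { carrier := {f | ∀ k, δ k ≠ p → f k = 0}
      zero_mem' := fun _ _ => rfl
      add_mem' := fun hf hg k hk => by simp [hf k hk, hg k hk]
      smul_mem' := fun c f hf k hk => by simp [hf k hk] }
  let e : M ≃ₗ[AddMonoidAlgebra R Λ] AddMonoidAlgebra R Λ ⊗[R] (κ → R) :=
    b.equiv ((Pi.basisFun R κ).baseChange (AddMonoidAlgebra R Λ)) (Equiv.refl κ)
  have he : ∀ k, e (b k) = 1 ⊗ₜ Pi.single k 1 := fun k => by simp [e]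
  refine ⟨κ → R, inferInstance, inferInstance, ℱ, isInternal_coordinates δ ℱ fun _ _ => Iff.rfl,
    inferInstance, inferInstance, e, fun c m hm => ?_, fun c z hz => ?_⟩
  · rw [← hM.sum_degProj_smul hb hm (b.sum_repr m), map_sum]
    refine Submodule.sum_mem _ fun k _ => ?_
    rw [map_smul, he, TensorProduct.smul_tmul', smul_eq_mul, mul_one]
    refine Submodule.subset_span ⟨c - δ k, δ k, sub_add_cancel _ _, _, degProj_mem _ _, _, ?_, rfl⟩
    intro i hi
    exact Pi.single_eq_of_ne (fun h => hi (congrArg δ h)) _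
  · induction hz using Submodule.span_induction with
    | zero => rw [map_zero]; exact Submodule.zero_mem _
    | add x y _ _ hx hy => rw [map_add]; exact Submodule.add_mem _ hx hy
    | smul r x _ hx =>
      rw [← IsScalarTower.algebraMap_smul (AddMonoidAlgebra R Λ) r x, map_smul,
        IsScalarTower.algebraMap_smul]
      exact Submodule.smul_mem _ r hx
    | mem z hz =>
      obtain ⟨a, p, rfl, x, hx, f, hf, rfl⟩ := hz
      have : x ⊗ₜ[R] f = e (∑ k, f k • x • b k) := by
        rw [map_sum]
        conv_lhs => rw [← Finset.univ_sum_single f, TensorProduct.tmul_sum]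
        refine Finset.sum_congr rfl fun k _ => ?_
        rw [← IsScalarTower.algebraMap_smul (AddMonoidAlgebra R Λ) (f k), map_smul, map_smul, he,
          IsScalarTower.algebraMap_smul, TensorProduct.smul_tmul', smul_eq_mul, mul_one,
          ← TensorProduct.tmul_smul, ← Pi.single_smul, smul_eq_mul, mul_one]
      rw [this, LinearEquiv.symm_apply_apply]
      refine Submodule.sum_mem _ fun k _ => ?_
      by_cases h : δ k = p
      · exact Submodule.smul_mem _ _ (hM.smul_mem hx (h ▸ hb k))
      · rw [hf k h, zero_smul]
        exact Submodule.zero_mem _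

end TrivialModules

section Transfer

variable {R T L P : Type*} [CommRing R] [AddCommMonoid T] [AddCommGroup L] [AddCommGroup P]

lemma mapDomain_mem_supportedOn_iff {φ : T →+ L} (hφ : Function.Injective φ) {Z : Set L}
    {x : AddMonoidAlgebra R T} :
    AddMonoidAlgebra.mapDomainRingHom R φ x ∈ supportedOn R Z ↔ x ∈ supportedOn R (φ ⁻¹' Z) := by
  have hcoeff : ∀ t, (AddMonoidAlgebra.mapDomainRingHom R φ x).coeff (φ t) = x.coeff t := fun t =>
    Finsupp.mapDomain_apply hφ _ t
  constructor
  · intro h t ht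
    exact h (φ t) (by rwa [hcoeff])
  · intro h s hs
    obtain ⟨t, rfl⟩ := mapDomain_mem_supportedOn φ x s hs
    exact h t (by rwa [← hcoeff])

/-- Homogeneous idempotent matrices over the monoid algebra of a cone split. -/
lemma exists_splitting_monoidAlgebra {q : ℕ} {l : Fin q → L →+ ℤ} {ψ : L →+ P} {S : AddSubmonoid L}
    (hS : (S : Set L) = {s | ∀ j, 0 ≤ l j s}) (h0 : ∀ J, SplitsAtLevelZero R l ψ J)
    (h1 : ∀ J, SplitsAtSomeLevel R l ψ J) {ι : Type} [Fintype ι] [DecidableEq ι] {d : ι → P}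
    {E : Matrix ι ι (AddMonoidAlgebra R S)}
    (hE : ∀ i k, E i k ∈ monAlgGrading R (ψ.comp S.subtype) (d i - d k)) (hEE : E * E = E) :
    ∃ (N : ℕ) (δ : Fin N → P) (X : Matrix ι (Fin N) (AddMonoidAlgebra R S))
      (Y : Matrix (Fin N) ι (AddMonoidAlgebra R S)),
      (∀ i k, X i k ∈ monAlgGrading R (ψ.comp S.subtype) (d i - δ k)) ∧ X * Y = E ∧ Y * X = 1 := by
  have hinj : Function.Injective S.subtype := S.subtype_injective
  have hlevel : ∀ p, S.subtype ⁻¹' levelSet l ψ ∅ 0 p = {s | ψ.comp S.subtype s = p} := by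
    intro p
    ext s
    have hs : ∀ j, 0 ≤ l j s := hS.le s.2
    simp [levelSet, hs]
  have hrange : ∀ p, ∀ s ∈ levelSet l ψ ∅ 0 p, s ∈ Set.range S.subtype := by
    intro p s hs
    exact ⟨⟨s, hS.ge fun j => hs.2.1 j (Finset.notMem_empty j)⟩, rfl⟩
  let m := AddMonoidAlgebra.mapDomainRingHom R S.subtype
  obtain ⟨N, δ, X, Y, h⟩ := exists_splitting h0 h1 (J := ∅) (E := E.map m)
    (fun i k => (mapDomain_mem_supportedOn_iff hinj).2 (by
      rw [hlevel, ← monAlgGrading_eq_supportedOn]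
      exact hE i k))
    (by rw [← Matrix.map_mul, hEE])
  choose X' hX' using fun i k => exists_mapDomain_eq (supportedOn_mono (h.left i k) (hrange _))
  choose Y' hY' using fun i k => exists_mapDomain_eq (supportedOn_mono (h.right i k) (hrange _))
  have hXm : (Matrix.of X').map m = X := Matrix.ext hX'
  have hYm : (Matrix.of Y').map m = Y := Matrix.ext hY'
  refine ⟨N, δ, Matrix.of X', Matrix.of Y', fun i k => ?_, ?_, ?_⟩
  · rw [monAlgGrading_eq_supportedOn, ← hlevel, ← mapDomain_mem_supportedOn_iff hinj]
    exact (hX' i k).symm ▸ h.left i k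
  · apply Matrix.map_injective (mapDomainRingHom_injective hinj)
    change (Matrix.of X' * Matrix.of Y').map m = E.map m
    rw [Matrix.map_mul, hXm, hYm, h.mul_eq]
  · apply Matrix.map_injective (mapDomainRingHom_injective hinj)
    change (Matrix.of Y' * Matrix.of X').map m = (1 : Matrix (Fin N) (Fin N) _).map m
    rw [Matrix.map_mul, hXm, hYm, h.mul_eq_one, Matrix.map_one _ (map_zero m) (map_one m)]

end Transfer

/-!
STATEMENT 0 (Theorem `Main thm 1` of Krishna–Ravi):
Let `R` be a commutative noetherian ring satisfying condition (†), `P` a finitely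
generated abelian group (so `G = Spec R[P]` is diagonalizable), `L` a lattice,
`σ ⊆ L_ℚ` a strongly convex rational polyhedral cone with set of faces `Δ`, and let
`ψ : L → P` make `A = R[σ ∩ L]` a `P`-graded `R`-algebra.  Assume that for every face
`τ ∈ Δ` all finitely generated projective modules over `A_τ = R[τ ∩ L]` and over the
degree-zero subring `(A_τ)^G = R[{m ∈ τ ∩ L | ψ m = 0}]` are extended from `R`.
Then every finitely generated `P`-graded `A`-module which is projective as an
`A`-module is trivial (equivariantly extended from `R`).
-/
theorem equivariant_bundles_on_affine_toric_schemes_are_trivial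
    (R : Type u) [CommRing R] [IsNoetherianRing R] (hR : CondDagger R)
    (P : Type u) [AddCommGroup P] [AddGroup.FG P] [DecidableEq P]
    (L : Type u) [AddCommGroup L] [Module.Free ℤ L] [Module.Finite ℤ L]
    (q : ℕ) (l : Fin q → L →+ ℚ) (hlne : ∀ i, l i ≠ 0)
    (hspan : SpansLattice (coneLatticePoints l))
    (ψ : L →+ P)
    (hfaces : ∀ l' : L →+ ℚ, (∀ m ∈ coneLatticePoints l, 0 ≤ l' m) →
      AllFGProjectiveExtended R (AddMonoidAlgebra R ↥(faceLatticePoints l l')) ∧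
      AllFGProjectiveExtended R
        (AddMonoidAlgebra R ↥(kerSubmonoidIn (faceLatticePoints l l') ψ)))
    (M : Type u) [AddCommGroup M] [Module R M]
    [Module (AddMonoidAlgebra R ↥(coneLatticePoints l)) M]
    [IsScalarTower R (AddMonoidAlgebra R ↥(coneLatticePoints l)) M]
    (ℳ : P → Submodule R M)
    (hM : IsGradedModule (monAlgGrading R (fun s : ↥(coneLatticePoints l) => ψ (s : L))) ℳ)
    (hfin : Module.Finite (AddMonoidAlgebra R ↥(coneLatticePoints l)) M)
    (hproj : Module.Projective (AddMonoidAlgebra R ↥(coneLatticePoints l)) M) :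
    IsGradedExtendedFrom R
      (monAlgGrading R (fun s : ↥(coneLatticePoints l) => ψ (s : L))) M ℳ := by
  have : AddGroup.FG L := Module.Finite.iff_addGroup_fg.1 inferInstance
  obtain ⟨D, hD, l', hl'⟩ := exists_integral_multiple l
  have hnonneg : ∀ j s, 0 ≤ l' j s ↔ 0 ≤ l j s := fun j s => by
    rw [← Int.cast_nonneg_iff (R := ℚ), hl', mul_nonneg_iff_of_pos_left (by exact_mod_cast hD)]
  have h0 : ∀ J, SplitsAtLevelZero R l' ψ J := fun J => by
    refine splitsAtLevelZero_of_extended hR.1 (hfaces (∑ j ∈ J, l j) fun m hm => ?_).2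
      (coe_kerSubmonoidIn_face hD hl')
    rw [AddMonoidHom.finsetSum_apply]
    exact Finset.sum_nonneg fun j _ => hm j
  have h1 : ∀ J, SplitsAtSomeLevel R l' ψ J := fun J => by
    refine splitsAtSomeLevel_of_extended (T := (⨅ j ∈ J, (l' j).ker) ⊓ ψ.ker) hR.1
      (hR.2 _ (isTorsionFreeAddMonoid_addSubgroup _)) ?_
    ext s
    simp
  have hS : (coneLatticePoints l : Set L) = {s | ∀ j, 0 ≤ l' j s} := by
    ext s
    simp only [hnonneg]
    rfl
  let deg : ↥(coneLatticePoints l) →+ P := ψ.comp (coneLatticePoints l).subtype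
  replace hM : IsGradedModule (monAlgGrading R deg) ℳ := hM
  obtain ⟨N, g, e, E, hg, hgen, hE, hEE, hEg, hker⟩ := hM.exists_idempotent
  obtain ⟨n, δ, X, Y, hX, h2, h3⟩ := exists_splitting_monoidAlgebra hS h0 h1 (d := fun i => -e i)
    (fun i k => by rw [neg_sub_neg]; exact hE i k) hEE
  obtain ⟨b, hb⟩ := hM.exists_basis (δ := fun k => -δ k) hg hgen hEg hker
    (fun i k => by rw [neg_sub_comm]; exact hX i k) h2 h3
  exact hM.isGradedExtendedFrom b hb
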